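/- For every constant C > 0 there exists a constant K = K(C) > 0 such that for all n ≥ 2, P(det(M_n) = 0 and rank(M_{n−1}) = n−1) ≤ K · n^{−C}, where M_{n−1} denotes the principal (n−1)×(n−1) submatrix of M_n obtained by deleting the first row and the first column. -/

import Mathlib

open scoped Classical BigOperators

noncomputable section

/-- The real number (±1) corresponding to a Boolean sign bit. -/
def signv (b : Bool) : ℝ := if b then 1 else -1

/-- The random symmetric Bernoulli (±1) matrix. -/
def symMat (n : ℕ) (g : Fin n → Fin n → Bool) : Matrix (Fin n) (Fin n) ℝ :=
  Matrix.of fun i j => if i ≤ j then signv (g i j) else signv (g j i)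

/-- Probability of an event for the random symmetric Bernoulli matrix. -/
def probSym (n : ℕ) (p : Matrix (Fin n) (Fin n) ℝ → Prop) : ℝ :=
  ((Finset.univ.filter fun g : Fin n → Fin n → Bool => p (symMat n g)).card : ℝ) /
    (Fintype.card (Fin n → Fin n → Bool) : ℝ)

/-- The sign `±1` in a ring attached to a Boolean. -/
def ringSign (R : Type*) [Ring R] (b : Bool) : R := if b then 1 else -1

/-- The cosine `cos (2πx/p)` of a residue `x` modulo `p`. -/
def resCos {p : ℕ} [NeZero p] (x : ZMod p) : ℝ := (ZMod.stdAddChar x : ℂ).re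

/-- The energy of the frequency `θ` with respect to the coefficients `v j`, `j ∈ S`. -/
def energy {p : ℕ} [NeZero p] {m : ℕ} (v : Fin m → ZMod p) (S : Finset (Fin m)) (θ : ZMod p) : ℝ :=
  ∑ j ∈ S, (1 - resCos (θ * v j)) / 2

/-- The Fourier-analytic bound for the concentration of the signed sum of `v j`, `j ∈ S`. -/
def conc {p : ℕ} [NeZero p] {m : ℕ} (v : Fin m → ZMod p) (S : Finset (Fin m)) : ℝ :=
  (∑ θ : ZMod p, Real.exp (-(energy v S θ / 2))) / p

section Fourier

variable {p : ℕ} [NeZero p] {m : ℕ}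

lemma normSq_stdAddChar (x : ZMod p) :
    (ZMod.stdAddChar x : ℂ).re ^ 2 + (ZMod.stdAddChar x : ℂ).im ^ 2 = 1 := by
  have h := AddChar.norm_apply (ZMod.stdAddChar (N := p)) x
  have h2 : Complex.normSq (ZMod.stdAddChar x : ℂ) = 1 := by
    rw [Complex.normSq_eq_norm_sq, h]; norm_num
  rw [Complex.normSq_apply] at h2
  nlinarith

lemma resCos_le_one (x : ZMod p) : resCos x ≤ 1 := by
  unfold resCos; nlinarith [normSq_stdAddChar x, sq_nonneg (ZMod.stdAddChar x : ℂ).im]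

lemma resCos_two_mul (x : ZMod p) : resCos (2 * x) = 2 * resCos x ^ 2 - 1 := by
  unfold resCos
  rw [two_mul, AddChar.map_add_eq_mul, Complex.mul_re]
  nlinarith [normSq_stdAddChar x]

lemma one_sub_resCos_add_le (x y : ZMod p) :
    1 - resCos (x + y) ≤ 2 * (1 - resCos x) + 2 * (1 - resCos y) := by
  unfold resCos
  rw [AddChar.map_add_eq_mul, Complex.mul_re]
  have hx := normSq_stdAddChar x
  have hy := normSq_stdAddChar y
  set a := (ZMod.stdAddChar x : ℂ).re
  set b := (ZMod.stdAddChar x : ℂ).im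
  set c := (ZMod.stdAddChar y : ℂ).re
  set d := (ZMod.stdAddChar y : ℂ).im
  nlinarith [sq_nonneg (a + c - 2), sq_nonneg (b - d), sq_nonneg (a - c), sq_nonneg (b + d)]

lemma energy_nonneg (v : Fin m → ZMod p) (S : Finset (Fin m)) (θ : ZMod p) : 0 ≤ energy v S θ :=
  Finset.sum_nonneg fun j _ => by linarith [resCos_le_one (θ * v j)]

lemma energy_add_le (v : Fin m → ZMod p) (S : Finset (Fin m)) (θ η : ZMod p) :
    energy v S (θ + η) ≤ 2 * energy v S θ + 2 * energy v S η := by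
  unfold energy
  rw [Finset.mul_sum, Finset.mul_sum, ← Finset.sum_add_distrib]
  refine Finset.sum_le_sum fun j _ => ?_
  rw [add_mul]
  linarith [one_sub_resCos_add_le (θ * v j) (η * v j)]

lemma energy_mono (v : Fin m → ZMod p) {S T : Finset (Fin m)} (h : S ⊆ T) (θ : ZMod p) :
    energy v S θ ≤ energy v T θ :=
  Finset.sum_le_sum_of_subset_of_nonneg h fun j _ _ => by linarith [resCos_le_one (θ * v j)]

lemma energy_congr {v w : Fin m → ZMod p} {S : Finset (Fin m)} (h : ∀ j ∈ S, v j = w j) (θ : ZMod p) :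
    energy v S θ = energy w S θ :=
  Finset.sum_congr rfl fun j hj => by rw [h j hj]

lemma conc_congr {v w : Fin m → ZMod p} {S : Finset (Fin m)} (h : ∀ j ∈ S, v j = w j) :
    conc v S = conc w S := by
  unfold conc; simp only [energy_congr h]

lemma conc_anti (v : Fin m → ZMod p) {S T : Finset (Fin m)} (h : S ⊆ T) : conc v T ≤ conc v S := by
  unfold conc
  gcongr with θ
  exact energy_mono v h θ

lemma conc_le_one (v : Fin m → ZMod p) (S : Finset (Fin m)) : conc v S ≤ 1 := by
  have hp : (0 : ℝ) < p := by exact_mod_cast Nat.pos_of_ne_zero (NeZero.ne p)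
  unfold conc
  rw [div_le_one hp]
  calc ∑ θ : ZMod p, Real.exp (-(energy v S θ / 2)) ≤ ∑ θ : ZMod p, (1 : ℝ) :=
        Finset.sum_le_sum fun θ _ => Real.exp_le_one_iff.2 (by linarith [energy_nonneg v S θ])
    _ = p := by simp

lemma conc_nonneg (v : Fin m → ZMod p) (S : Finset (Fin m)) : 0 ≤ conc v S := by
  unfold conc; positivity

lemma sum_stdAddChar_mul (a : ZMod p) :
    ∑ θ : ZMod p, (ZMod.stdAddChar (θ * a) : ℂ) = if a = 0 then (p : ℂ) else 0 := by
  rw [AddChar.sum_mulShift a (ZMod.isPrimitive_stdAddChar p)]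
  split_ifs <;> simp

lemma sum_resCos_mul {a : ZMod p} (ha : a ≠ 0) : ∑ θ : ZMod p, resCos (θ * a) = 0 := by
  unfold resCos
  rw [← Complex.re_sum, sum_stdAddChar_mul, if_neg ha, Complex.zero_re]

/-- Counting solutions of `F ω = x` by characters. -/
lemma card_filter_eq_sum_char {Ω : Type*} (A : Finset Ω) (F : Ω → ZMod p) (x : ZMod p) :
    (p : ℂ) * ((A.filter fun ω => F ω = x).card : ℂ) =
      ∑ θ : ZMod p, ZMod.stdAddChar (-(θ * x)) * ∑ ω ∈ A, (ZMod.stdAddChar (θ * F ω) : ℂ) := by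
  calc (p : ℂ) * ((A.filter fun ω => F ω = x).card : ℂ)
      = ∑ ω ∈ A, if F ω - x = 0 then (p : ℂ) else 0 := by
        simp_rw [sub_eq_zero]
        rw [← Finset.sum_filter, Finset.sum_const, nsmul_eq_mul, mul_comm]
    _ = ∑ ω ∈ A, ∑ θ : ZMod p, (ZMod.stdAddChar (θ * (F ω - x)) : ℂ) := by
        simp_rw [sum_stdAddChar_mul]
    _ = _ := by
        rw [Finset.sum_comm]
        refine Finset.sum_congr rfl fun θ _ => ?_
        rw [Finset.mul_sum]
        refine Finset.sum_congr rfl fun ω _ => ?_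
        rw [← AddChar.map_add_eq_mul]
        congr 1; ring

lemma map_sum_stdAddChar {κ : Type*} (s : Finset κ) (f : κ → ZMod p) :
    (ZMod.stdAddChar (∑ j ∈ s, f j) : ℂ) = ∏ j ∈ s, (ZMod.stdAddChar (f j) : ℂ) := by
  induction s using Finset.induction_on with
  | empty => simp
  | insert a s ha ih => rw [Finset.sum_insert ha, Finset.prod_insert ha, AddChar.map_add_eq_mul, ih]

lemma stdAddChar_add_neg (x : ZMod p) :
    (ZMod.stdAddChar x : ℂ) + ZMod.stdAddChar (-x) = ((2 * resCos x : ℝ) : ℂ) := by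
  rw [AddChar.map_neg_eq_conj, Complex.add_conj]; rfl

lemma sum_bool_stdAddChar (θ a : ZMod p) :
    ∑ b : Bool, (ZMod.stdAddChar (θ * (ringSign (ZMod p) b * a)) : ℂ) =
      ((2 * resCos (θ * a) : ℝ) : ℂ) := by
  rw [← stdAddChar_add_neg]
  simp [ringSign]

lemma abs_resCos_le (x : ZMod p) : |resCos x| ≤ Real.exp (-((1 - resCos (2 * x)) / 2 / 2)) := by
  have h : resCos x ^ 2 ≤ (Real.exp (-((1 - resCos (2 * x)) / 2 / 2))) ^ 2 := by
    rw [← Real.exp_nat_mul]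
    have := Real.add_one_le_exp (((2 : ℕ) : ℝ) * -((1 - resCos (2 * x)) / 2 / 2))
    have h2 := resCos_two_mul x
    push_cast at this ⊢
    linarith
  exact abs_le_of_sq_le_sq h (Real.exp_pos _).le

lemma prod_abs_resCos_le (v : Fin m → ZMod p) (S : Finset (Fin m)) (θ : ZMod p) :
    ∏ j ∈ S, |resCos (θ * v j)| ≤ Real.exp (-(energy v S (2 * θ) / 2)) := by
  calc ∏ j ∈ S, |resCos (θ * v j)|
      ≤ ∏ j ∈ S, Real.exp (-((1 - resCos (2 * (θ * v j))) / 2 / 2)) :=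
        Finset.prod_le_prod (fun _ _ => abs_nonneg _) fun _ _ => abs_resCos_le _
    _ = _ := by
        rw [← Real.exp_sum]
        congr 1
        unfold energy
        rw [Finset.sum_neg_distrib, Finset.sum_div]
        simp only [mul_assoc]

end Fourier

/-- The number of sign patterns for which the signed sum over `S` hits a given value is controlled
by `conc`. -/
lemma card_signed_sum_le {p : ℕ} [Fact p.Prime] (hp2 : p ≠ 2) {m : ℕ} (v : Fin m → ZMod p)
    (S : Finset (Fin m)) (x : ZMod p) :
    ((Finset.univ.filter fun ξ : Fin m → Bool =>
      ∑ j ∈ S, ringSign (ZMod p) (ξ j) * v j = x).card : ℝ) ≤ conc v S * 2 ^ m := by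
  have hp : (0 : ℝ) < p := by exact_mod_cast (Fact.out : p.Prime).pos
  have key := card_filter_eq_sum_char Finset.univ
    (fun ξ : Fin m → Bool => ∑ j ∈ S, ringSign (ZMod p) (ξ j) * v j) x
  have hsum : ∀ θ : ZMod p, ∑ ξ : Fin m → Bool,
      (ZMod.stdAddChar (θ * ∑ j ∈ S, ringSign (ZMod p) (ξ j) * v j) : ℂ) =
      ∏ j : Fin m, if j ∈ S then ((2 * resCos (θ * v j) : ℝ) : ℂ) else 2 := by
    intro θ
    have h1 : ∀ ξ : Fin m → Bool,
        (ZMod.stdAddChar (θ * ∑ j ∈ S, ringSign (ZMod p) (ξ j) * v j) : ℂ) =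
        ∏ j : Fin m, if j ∈ S then
          (ZMod.stdAddChar (θ * (ringSign (ZMod p) (ξ j) * v j)) : ℂ) else 1 := by
      intro ξ
      rw [Finset.mul_sum, Finset.prod_ite_mem, Finset.univ_inter]
      exact map_sum_stdAddChar _ _
    simp_rw [h1]
    have h2 := Finset.prod_univ_sum (fun _ : Fin m => (Finset.univ : Finset Bool))
      (fun j b => if j ∈ S then
          (ZMod.stdAddChar (θ * (ringSign (ZMod p) b * v j)) : ℂ) else 1)
    rw [Fintype.piFinset_univ] at h2
    rw [← h2]
    refine Finset.prod_congr rfl fun j _ => ?_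
    split_ifs
    · exact sum_bool_stdAddChar _ _
    · simp
  have hnorm : ∀ θ : ZMod p, ‖∏ j : Fin m, if j ∈ S then ((2 * resCos (θ * v j) : ℝ) : ℂ) else 2‖ ≤
      2 ^ m * Real.exp (-(energy v S (2 * θ) / 2)) := by
    intro θ
    rw [norm_prod]
    have : ∀ j : Fin m, ‖if j ∈ S then ((2 * resCos (θ * v j) : ℝ) : ℂ) else 2‖ =
        2 * (if j ∈ S then |resCos (θ * v j)| else 1) := by
      intro j
      split_ifs
      · rw [Complex.norm_real, Real.norm_eq_abs, abs_mul]; norm_num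
      · simp
    simp_rw [this]
    rw [Finset.prod_mul_distrib, Finset.prod_const, Finset.card_univ, Fintype.card_fin,
      Finset.prod_ite_mem, Finset.univ_inter]
    gcongr
    exact prod_abs_resCos_le v S θ
  have h2 : (2 : ZMod p) ≠ 0 := by
    intro h
    have : ((2 : ℕ) : ZMod p) = 0 := by exact_mod_cast h
    rw [ZMod.natCast_eq_zero_iff] at this
    exact hp2 ((Nat.prime_dvd_prime_iff_eq Fact.out Nat.prime_two).1 this)
  have hperm : ∑ θ : ZMod p, Real.exp (-(energy v S (2 * θ) / 2)) =
      ∑ θ : ZMod p, Real.exp (-(energy v S θ / 2)) :=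
    Equiv.sum_comp (Equiv.mulLeft₀ (2 : ZMod p) h2) fun θ => Real.exp (-(energy v S θ / 2))
  have hfin : (p : ℝ) * ((Finset.univ.filter fun ξ : Fin m → Bool =>
      ∑ j ∈ S, ringSign (ZMod p) (ξ j) * v j = x).card : ℝ) ≤
      2 ^ m * ∑ θ : ZMod p, Real.exp (-(energy v S θ / 2)) := by
    have h3 := congrArg norm key
    rw [norm_mul, Complex.norm_natCast, Complex.norm_natCast] at h3
    rw [h3, ← hperm, Finset.mul_sum]
    refine (norm_sum_le _ _).trans (Finset.sum_le_sum fun θ _ => ?_)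
    rw [norm_mul, AddChar.norm_apply, one_mul, hsum]
    exact hnorm θ
  unfold conc
  rw [div_mul_eq_mul_div, le_div_iff₀ hp]
  linarith

/-- The number of `L`-term signed sums of the `v j`, `j ∈ Y`, which are equal to `x`. -/
def sumCount {p m : ℕ} (L : ℕ) (v : Fin m → ZMod p) (Y : Finset (Fin m)) (x : ZMod p) : ℕ :=
  ((Fintype.piFinset fun _ : Fin L => Y ×ˢ (Finset.univ : Finset Bool)).filter fun g =>
    ∑ q, ringSign (ZMod p) (g q).2 * v (g q).1 = x).card

/-- The frequencies of energy at most `t`. -/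
def lowEnergy {p : ℕ} [NeZero p] {m : ℕ} (v : Fin m → ZMod p) (S : Finset (Fin m)) (t : ℝ) :
    Finset (ZMod p) :=
  Finset.univ.filter fun θ => energy v S θ ≤ t

section Halasz

variable {p : ℕ} [Fact p.Prime] {m : ℕ}

lemma sum_energy {v : Fin m → ZMod p} {S : Finset (Fin m)} (hv : ∀ j ∈ S, v j ≠ 0) :
    ∑ θ, energy v S θ = (p : ℝ) * (S.card / 2) := by
  unfold energy
  rw [Finset.sum_comm]
  have : ∀ j ∈ S, ∑ θ : ZMod p, (1 - resCos (θ * v j)) / 2 = p / 2 := by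
    intro j hj
    rw [← Finset.sum_div, Finset.sum_sub_distrib, sum_resCos_mul (hv j hj)]
    simp
  rw [Finset.sum_congr rfl this]
  simp; ring

lemma card_lowEnergy_lt {v : Fin m → ZMod p} {S : Finset (Fin m)} (hv : ∀ j ∈ S, v j ≠ 0) {t : ℝ}
    (ht : t < S.card / 2) : (lowEnergy v S t).card < p := by
  have hp : (0 : ℝ) < p := by exact_mod_cast (Fact.out : p.Prime).pos
  by_contra! h
  have huniv : lowEnergy v S t = Finset.univ := by
    apply Finset.eq_univ_of_card
    rw [ZMod.card]
    exact le_antisymm ((Finset.card_le_univ _).trans_eq (ZMod.card p)) h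
  have h1 : ∑ θ, energy v S θ ≤ ∑ θ : ZMod p, t := by
    refine Finset.sum_le_sum fun θ _ => ?_
    have : θ ∈ lowEnergy v S t := huniv ▸ Finset.mem_univ θ
    exact (Finset.mem_filter.1 this).2
  rw [sum_energy hv] at h1
  simp at h1
  nlinarith

lemma zero_mem_lowEnergy (v : Fin m → ZMod p) (S : Finset (Fin m)) {t : ℝ} (ht : 0 ≤ t) :
    (0 : ZMod p) ∈ lowEnergy v S t := by
  refine Finset.mem_filter.2 ⟨Finset.mem_univ _, ?_⟩
  simp [energy, resCos, ht]

open Pointwise in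
lemma card_lowEnergy_doubling {v : Fin m → ZMod p} {S : Finset (Fin m)} (hv : ∀ j ∈ S, v j ≠ 0)
    {t : ℝ} (ht0 : 0 ≤ t) (ht : 4 * t < S.card / 2) :
    2 * (((lowEnergy v S t).card : ℝ) - 1) ≤ ((lowEnergy v S (4 * t)).card : ℝ) - 1 := by
  have hne : (lowEnergy v S t).Nonempty := ⟨0, zero_mem_lowEnergy v S ht0⟩
  have hcd := ZMod.cauchy_davenport (Fact.out : p.Prime) hne hne
  have hsub : lowEnergy v S t + lowEnergy v S t ⊆ lowEnergy v S (4 * t) := by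
    intro x hx
    obtain ⟨a, ha, b, hb, rfl⟩ := Finset.mem_add.1 hx
    have ha := (Finset.mem_filter.1 ha).2
    have hb := (Finset.mem_filter.1 hb).2
    refine Finset.mem_filter.2 ⟨Finset.mem_univ _, ?_⟩
    linarith [energy_add_le v S a b]
  have h1 := hcd.trans (Finset.card_le_card hsub)
  have h2 := card_lowEnergy_lt hv ht
  have h3 := hne.card_pos
  have h4 : 2 * (lowEnergy v S t).card ≤ (lowEnergy v S (4 * t)).card + 1 := by omega
  have h5 : 2 * ((lowEnergy v S t).card : ℝ) ≤ (lowEnergy v S (4 * t)).card + 1 := by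
    exact_mod_cast h4
  linarith

lemma card_lowEnergy_growth {v : Fin m → ZMod p} {S : Finset (Fin m)} (hv : ∀ j ∈ S, v j ≠ 0)
    {t : ℝ} (ht0 : 0 ≤ t) (k : ℕ) (ht : 4 ^ k * t < S.card / 2) :
    2 ^ k * (((lowEnergy v S t).card : ℝ) - 1) ≤ ((lowEnergy v S (4 ^ k * t)).card : ℝ) - 1 := by
  induction k with
  | zero => simp
  | succ k ih =>
    have h0 : (0 : ℝ) ≤ 4 ^ k * t := by positivity
    have h1 : (4 : ℝ) ^ (k + 1) * t = 4 * (4 ^ k * t) := by ring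
    rw [h1] at ht ⊢
    have h2 := ih (by linarith)
    have h3 := card_lowEnergy_doubling hv h0 ht
    calc (2 : ℝ) ^ (k + 1) * (((lowEnergy v S t).card : ℝ) - 1)
        = 2 * (2 ^ k * (((lowEnergy v S t).card : ℝ) - 1)) := by ring
      _ ≤ _ := by linarith

lemma lowEnergy_mono (v : Fin m → ZMod p) (S : Finset (Fin m)) {t t' : ℝ} (h : t ≤ t') :
    lowEnergy v S t ⊆ lowEnergy v S t' :=
  Finset.monotone_filter_right _ fun _ _ h' => h'.trans h

lemma conc_le_card_lowEnergy (v : Fin m → ZMod p) (S : Finset (Fin m)) (t : ℝ) :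
    conc v S ≤ (lowEnergy v S t).card / p + Real.exp (-(t / 2)) := by
  have hp : (0 : ℝ) < p := by exact_mod_cast (Fact.out : p.Prime).pos
  unfold conc
  rw [div_add' _ _ _ hp.ne', div_le_div_iff_of_pos_right hp]
  calc ∑ θ : ZMod p, Real.exp (-(energy v S θ / 2))
      ≤ ∑ θ : ZMod p, ((if θ ∈ lowEnergy v S t then 1 else 0) + Real.exp (-(t / 2))) := by
        refine Finset.sum_le_sum fun θ _ => ?_
        split_ifs with h
        · have : Real.exp (-(energy v S θ / 2)) ≤ 1 :=
            Real.exp_le_one_iff.2 (by linarith [energy_nonneg v S θ])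
          linarith [Real.exp_pos (-(t / 2))]
        · have h' : t < energy v S θ := by simpa [lowEnergy] using h
          rw [zero_add]
          exact Real.exp_le_exp.2 (by linarith)
    _ = _ := by
        rw [Finset.sum_add_distrib]
        simp [mul_comm]

/-- Halász-type growth: large concentration forces many frequencies of small energy. -/
lemma card_lowEnergy_ge {v : Fin m → ZMod p} {S : Finset (Fin m)} (hv : ∀ j ∈ S, v j ≠ 0)
    {ρ t : ℝ} (k : ℕ) (ht0 : 0 ≤ t) (hρ : ρ ≤ conc v S) (hρp : 4 ≤ ρ * p)
    (hexp : Real.exp (-(t / 2)) ≤ ρ / 4) (ht : 4 ^ k * t ≤ S.card / 16) (hS : 0 < S.card) :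
    2 ^ k * (ρ / 4) * p ≤ (lowEnergy v S (S.card / 16)).card := by
  have hp : (0 : ℝ) < p := by exact_mod_cast (Fact.out : p.Prime).pos
  have hS' : (0 : ℝ) < S.card := by exact_mod_cast hS
  have h1 := conc_le_card_lowEnergy v S t
  have h2 : 3 / 4 * ρ * p ≤ (lowEnergy v S t).card := by
    rw [← le_div_iff₀ hp]; linarith
  have h3 := card_lowEnergy_growth hv ht0 k (by linarith)
  have h4 : ((lowEnergy v S (4 ^ k * t)).card : ℝ) ≤ (lowEnergy v S (S.card / 16)).card := by
    exact_mod_cast Finset.card_le_card (lowEnergy_mono v S ht)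
  have h5 : ρ / 4 * p ≤ ((lowEnergy v S t).card : ℝ) - 1 := by nlinarith
  have h6 : (2 : ℝ) ^ k * (ρ / 4 * p) ≤ 2 ^ k * (((lowEnergy v S t).card : ℝ) - 1) := by gcongr
  nlinarith

lemma sum_resCos_eq (v : Fin m → ZMod p) (S : Finset (Fin m)) (θ : ZMod p) :
    ∑ j ∈ S, resCos (θ * v j) = S.card - 2 * energy v S θ := by
  unfold energy
  rw [Finset.mul_sum, eq_sub_iff_add_eq, ← Finset.sum_add_distrib]
  rw [Finset.sum_congr rfl (fun j _ => show resCos (θ * v j) + 2 * ((1 - resCos (θ * v j)) / 2) = 1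
    by ring)]
  simp

/-- The moment identity for the number of vanishing signed sums. -/
lemma sumCount_zero_eq (L : ℕ) (v : Fin m → ZMod p) (S : Finset (Fin m)) :
    (p : ℝ) * sumCount L v S 0 = ∑ θ : ZMod p, (2 * ∑ j ∈ S, resCos (θ * v j)) ^ L := by
  have key := card_filter_eq_sum_char
    (Fintype.piFinset fun _ : Fin L => S ×ˢ (Finset.univ : Finset Bool))
    (fun g => ∑ q, ringSign (ZMod p) (g q).2 * v (g q).1) 0
  have hsum : ∀ θ : ZMod p,
      ∑ g ∈ Fintype.piFinset fun _ : Fin L => S ×ˢ (Finset.univ : Finset Bool),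
        (ZMod.stdAddChar (θ * ∑ q, ringSign (ZMod p) (g q).2 * v (g q).1) : ℂ) =
      (((2 * ∑ j ∈ S, resCos (θ * v j)) ^ L : ℝ) : ℂ) := by
    intro θ
    have h1 := Finset.sum_pow' (S ×ˢ (Finset.univ : Finset Bool))
      (fun a => (ZMod.stdAddChar (θ * (ringSign (ZMod p) a.2 * v a.1)) : ℂ)) L
    rw [Finset.sum_product] at h1
    simp_rw [sum_bool_stdAddChar] at h1
    rw [Finset.mul_sum, Complex.ofReal_pow, Complex.ofReal_sum, h1]
    refine Finset.sum_congr rfl fun g _ => ?_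
    rw [Finset.mul_sum, map_sum_stdAddChar]
  simp_rw [hsum, mul_zero, neg_zero, AddChar.map_zero_eq_one, one_mul] at key
  exact_mod_cast key

/-- Large concentration forces many additive relations. -/
lemma sumCount_zero_ge {v : Fin m → ZMod p} {S : Finset (Fin m)} (hv : ∀ j ∈ S, v j ≠ 0)
    {ρ t : ℝ} (k l : ℕ) (ht0 : 0 ≤ t) (hρ : ρ ≤ conc v S) (hρp : 4 ≤ ρ * p)
    (hexp : Real.exp (-(t / 2)) ≤ ρ / 4) (ht : 4 ^ k * t ≤ S.card / 16) (hS : 0 < S.card) :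
    2 ^ k * (ρ / 4) * (S.card : ℝ) ^ (2 * l) ≤ sumCount (2 * l) v S 0 := by
  have hp : (0 : ℝ) < p := by exact_mod_cast (Fact.out : p.Prime).pos
  have h1 := card_lowEnergy_ge hv k ht0 hρ hρp hexp ht hS
  have h2 := sumCount_zero_eq (2 * l) v S
  have h3 : ∑ θ ∈ lowEnergy v S (S.card / 16), (S.card : ℝ) ^ (2 * l) ≤
      ∑ θ : ZMod p, (2 * ∑ j ∈ S, resCos (θ * v j)) ^ (2 * l) := by
    refine (Finset.sum_le_sum fun θ hθ => ?_).trans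
      (Finset.sum_le_sum_of_subset_of_nonneg (Finset.subset_univ _)
        fun θ _ _ => (even_two_mul l).pow_nonneg _)
    have := (Finset.mem_filter.1 hθ).2
    rw [sum_resCos_eq]
    have hc : (0 : ℝ) ≤ S.card := by positivity
    gcongr
    linarith
  rw [Finset.sum_const, nsmul_eq_mul, ← h2] at h3
  have h4 : 2 ^ k * (ρ / 4) * p * (S.card : ℝ) ^ (2 * l) ≤ p * sumCount (2 * l) v S 0 := by
    refine le_trans ?_ h3
    gcongr
  have h5 : (p : ℝ) * (2 ^ k * (ρ / 4) * (S.card : ℝ) ^ (2 * l)) ≤ p * sumCount (2 * l) v S 0 := by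
    linarith
  exact le_of_mul_le_mul_left h5 hp

end Halasz

section Relations

/-- A map in which no value is attained exactly once factors through few values. -/
lemma exists_factor_of_no_unique {α : Type*} {l : ℕ} (hl : 0 < l) (h : Fin (2 * l) → α)
    (hh : ∀ q, ∃ q', q' ≠ q ∧ h q' = h q) :
    ∃ (a : Fin l → Fin (2 * l)) (b : Fin (2 * l) → Fin l), ∀ q, h q = h (a (b q)) := by
  set T := Finset.univ.image h with hT
  have hcard : T.card ≤ l := by
    have := Finset.mul_card_image_le_card (f := h) Finset.univ 2 (by
      intro x hx
      obtain ⟨q, -, rfl⟩ := Finset.mem_image.1 hx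
      obtain ⟨q', hne, hq'⟩ := hh q
      refine (Finset.card_pair hne.symm).symm.le.trans (Finset.card_le_card ?_)
      intro y hy
      rcases Finset.mem_insert.1 hy with rfl | hy
      · simp
      · rw [Finset.mem_singleton.1 hy]; simp [hq'])
    simp at this
    exact this
  have hne : Nonempty T := ⟨⟨h ⟨0, by omega⟩, Finset.mem_image_of_mem _ (Finset.mem_univ _)⟩⟩
  obtain ⟨e⟩ : Nonempty (T ↪ Fin l) := Function.Embedding.nonempty_of_card_le (by simpa using hcard)
  have hmem : ∀ q, h q ∈ T := fun q => Finset.mem_image_of_mem _ (Finset.mem_univ _)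
  have hpre : ∀ x : T, ∃ q, h q = x := fun x => by
    obtain ⟨q, -, hq⟩ := Finset.mem_image.1 x.2
    exact ⟨q, hq⟩
  choose pre hpre using hpre
  refine ⟨fun i => pre (Function.invFun e i), fun q => e ⟨h q, hmem q⟩, fun q => ?_⟩
  rw [hpre, Function.leftInverse_invFun e.injective]

variable {p m : ℕ}

lemma card_no_unique_le {l : ℕ} (hl : 0 < l) (P : Finset (Fin m)) :
    ((Fintype.piFinset fun _ : Fin (2 * l) => P ×ˢ (Finset.univ : Finset Bool)).filter fun g =>
      ∀ q, ∃ q', q' ≠ q ∧ (g q').1 = (g q).1).card ≤ l ^ (2 * l) * P.card ^ l * 2 ^ (2 * l) := by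
  set T := (Finset.univ : Finset (Fin (2 * l) → Fin l)) ×ˢ
    ((Fintype.piFinset fun _ : Fin l => P) ×ˢ (Finset.univ : Finset (Fin (2 * l) → Bool))) with hT
  have hTc : T.card = l ^ (2 * l) * P.card ^ l * 2 ^ (2 * l) := by
    rw [hT, Finset.card_product, Finset.card_product, Fintype.card_piFinset]
    simp [mul_assoc]
  rw [← hTc]
  refine (Finset.card_le_card ?_).trans
    (Finset.card_image_le (f := fun x : (Fin (2 * l) → Fin l) × ((Fin l → Fin m) ×
      (Fin (2 * l) → Bool)) => fun q => (x.2.1 (x.1 q), x.2.2 q)))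
  intro g hg
  obtain ⟨hg1, hg2⟩ := Finset.mem_filter.1 hg
  rw [Fintype.mem_piFinset] at hg1
  obtain ⟨a, b, hab⟩ := exists_factor_of_no_unique hl (fun q => (g q).1) hg2
  refine Finset.mem_image.2 ⟨(b, (fun i => (g (a i)).1, fun q => (g q).2)), ?_, ?_⟩
  · rw [hT]
    simp only [Finset.mem_product, Finset.mem_univ, Fintype.mem_piFinset, true_and, and_true]
    exact fun i => (Finset.mem_product.1 (hg1 (a i))).1
  · funext q
    exact Prod.ext (hab q).symm rfl

lemma ringSign_not (R : Type*) [Ring R] (b : Bool) : ringSign R (!b) = -ringSign R b := by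
  cases b <;> simp [ringSign]

lemma sumCount_neg (L : ℕ) (v : Fin m → ZMod p) (Y : Finset (Fin m)) (x : ZMod p) :
    sumCount L v Y (-x) ≤ sumCount L v Y x := by
  unfold sumCount
  refine Finset.card_le_card_of_injOn (fun g q => ((g q).1, !(g q).2)) ?_ ?_
  · intro g hg
    obtain ⟨h1, h2⟩ := Finset.mem_filter.1 hg
    refine Finset.mem_coe.2 (Finset.mem_filter.2 ⟨?_, ?_⟩)
    · rw [Fintype.mem_piFinset] at h1 ⊢
      intro q
      have := h1 q
      simp at this ⊢
      exact this
    · rw [← neg_neg x, ← h2, ← Finset.sum_neg_distrib]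
      refine Finset.sum_congr rfl fun q _ => ?_
      rw [ringSign_not, neg_mul]
  · intro g _ g' _ h
    funext q
    have := congrFun h q
    simp only [Prod.mk.injEq, Bool.not_inj_iff] at this
    exact Prod.ext this.1 this.2

lemma card_with_unique_le (L : ℕ) (v : Fin m → ZMod p) (P : Finset (Fin m)) (q : Fin (L + 1))
    (i : Fin m) (b : Bool) :
    ((Fintype.piFinset fun _ : Fin (L + 1) => P ×ˢ (Finset.univ : Finset Bool)).filter fun g =>
      (∑ q, ringSign (ZMod p) (g q).2 * v (g q).1 = 0 ∧ g q = (i, b)) ∧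
        ∀ q', q' ≠ q → (g q').1 ≠ i).card ≤ sumCount L v (P.erase i) (v i) := by
  have hb : sumCount L v (P.erase i) (-(ringSign (ZMod p) b * v i)) ≤
      sumCount L v (P.erase i) (v i) := by
    cases b
    · simp [ringSign]
    · simpa [ringSign] using sumCount_neg L v (P.erase i) (v i)
  refine le_trans ?_ hb
  unfold sumCount
  refine Finset.card_le_card_of_injOn (fun g => fun r => g (q.succAbove r)) ?_ ?_
  · intro g hg
    obtain ⟨h1, ⟨h2, h3⟩, h4⟩ := Finset.mem_filter.1 hg
    rw [Fintype.mem_piFinset] at h1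
    refine Finset.mem_coe.2 (Finset.mem_filter.2 ⟨?_, ?_⟩)
    · rw [Fintype.mem_piFinset]
      intro r
      have := h1 (q.succAbove r)
      simp only [Finset.mem_product, Finset.mem_univ, and_true, Finset.mem_erase] at this ⊢
      exact ⟨h4 _ (Fin.succAbove_ne q r), this⟩
    · rw [Fin.sum_univ_succAbove _ q, h3] at h2
      exact eq_neg_of_add_eq_zero_right h2
  · intro g hg g' hg' h
    obtain ⟨-, ⟨-, h3⟩, -⟩ := Finset.mem_filter.1 hg
    obtain ⟨-, ⟨-, h3'⟩, -⟩ := Finset.mem_filter.1 hg'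
    funext r
    rcases eq_or_ne r q with rfl | hr
    · rw [h3, h3']
    · obtain ⟨z, rfl⟩ := Fin.exists_succAbove_eq hr
      exact congrFun h z

/-- Many vanishing signed sums produce an element which is a signed sum of the others in many
ways. -/
lemma exists_rich {l L : ℕ} (hl : 0 < l) (hL : L + 1 = 2 * l) (v : Fin m → ZMod p)
    {P : Finset (Fin m)} (hP : P.Nonempty) {τ : ℝ}
    (h : (l : ℝ) ^ (2 * l) * P.card ^ l * 2 ^ (2 * l) + 4 * l * P.card * τ ≤
      sumCount (2 * l) v P 0) :
    ∃ i ∈ P, τ ≤ sumCount L v (P.erase i) (v i) := by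
  by_contra! hcon
  have h1 := card_no_unique_le hl P
  rw [← hL] at h1 h
  set A := Fintype.piFinset fun _ : Fin (L + 1) => P ×ˢ (Finset.univ : Finset Bool) with hA
  set B : Fin (L + 1) × Fin m × Bool → Finset (Fin (L + 1) → Fin m × Bool) := fun x =>
    A.filter fun g =>
      (∑ q, ringSign (ZMod p) (g q).2 * v (g q).1 = 0 ∧ g x.1 = (x.2.1, x.2.2)) ∧
        ∀ q', q' ≠ x.1 → (g q').1 ≠ x.2.1 with hB
  set X := (Finset.univ : Finset (Fin (L + 1))) ×ˢ (P ×ˢ (Finset.univ : Finset Bool)) with hX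
  have hcover : A.filter (fun g => ∑ q, ringSign (ZMod p) (g q).2 * v (g q).1 = 0) ⊆
      (A.filter fun g => ∀ q, ∃ q', q' ≠ q ∧ (g q').1 = (g q).1) ∪ X.biUnion B := by
    intro g hg
    obtain ⟨hg1, hg2⟩ := Finset.mem_filter.1 hg
    by_cases hu : ∀ q, ∃ q', q' ≠ q ∧ (g q').1 = (g q).1
    · exact Finset.mem_union_left _ (Finset.mem_filter.2 ⟨hg1, hu⟩)
    · push Not at hu
      obtain ⟨q, hq⟩ := hu
      refine Finset.mem_union_right _ (Finset.mem_biUnion.2 ⟨(q, g q), ?_, ?_⟩)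
      · rw [hX]
        have := (Fintype.mem_piFinset.1 hg1) q
        simp only [Finset.mem_product, Finset.mem_univ, and_true, true_and] at this ⊢
        exact this
      · exact Finset.mem_filter.2 ⟨hg1, ⟨hg2, rfl⟩, hq⟩
  have h2 : sumCount (L + 1) v P 0 ≤ _ := (Finset.card_le_card hcover).trans
    ((Finset.card_union_le _ _).trans (add_le_add h1 Finset.card_biUnion_le))
  have h3 : ∑ x ∈ X, ((B x).card : ℝ) < ∑ x ∈ X, τ := by
    refine Finset.sum_lt_sum_of_nonempty ?_ ?_
    · obtain ⟨i, hi⟩ := hP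
      exact ⟨(0, i, true), by simp [hX, hi]⟩
    · rintro ⟨q, i, b⟩ hx
      have hi : i ∈ P := by simpa [hX] using hx
      refine lt_of_le_of_lt ?_ (hcon i hi)
      exact_mod_cast card_with_unique_le L v P q i b
  have h4 : (X.card : ℝ) = 4 * l * P.card := by
    rw [hX, Finset.card_product, Finset.card_product, Finset.card_univ, Finset.card_univ,
      Fintype.card_fin, hL]
    simp; ring
  rw [Finset.sum_const, nsmul_eq_mul, h4] at h3
  have h5 : (sumCount (L + 1) v P 0 : ℝ) ≤
      (l : ℝ) ^ (L + 1) * P.card ^ l * 2 ^ (L + 1) + ∑ x ∈ X, ((B x).card : ℝ) := by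
    exact_mod_cast h2
  linarith

end Relations

section Counting

variable {p m : ℕ}

lemma sumCount_mono (L : ℕ) (v : Fin m → ZMod p) {Y Z : Finset (Fin m)} (h : Y ⊆ Z) (x : ZMod p) :
    sumCount L v Y x ≤ sumCount L v Z x := by
  unfold sumCount
  refine Finset.card_le_card (Finset.filter_subset_filter _ ?_)
  exact Fintype.piFinset_subset _ _ fun _ => Finset.product_subset_product_left h

lemma sumCount_congr (L : ℕ) {v w : Fin m → ZMod p} {Y : Finset (Fin m)} (h : ∀ i ∈ Y, v i = w i)
    (x : ZMod p) : sumCount L v Y x = sumCount L w Y x := by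
  unfold sumCount
  congr 1
  refine Finset.filter_congr fun g hg => ?_
  rw [Fintype.mem_piFinset] at hg
  rw [Finset.sum_congr rfl fun q _ => by rw [h _ (Finset.mem_product.1 (hg q)).1]]

lemma sumCount_le (L : ℕ) (v : Fin m → ZMod p) (Y : Finset (Fin m)) (x : ZMod p) :
    sumCount L v Y x ≤ (2 * m) ^ L := by
  unfold sumCount
  refine (Finset.card_filter_le _ _).trans ?_
  rw [Fintype.card_piFinset]
  simp only [Finset.card_product, Finset.prod_const, Finset.card_univ, Fintype.card_bool,
    Fintype.card_fin]
  refine Nat.pow_le_pow_left ?_ _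
  rw [mul_comm]
  exact Nat.mul_le_mul_left _ ((Finset.card_le_univ Y).trans_eq (Fintype.card_fin m))

lemma card_frequent_values_le [NeZero p] (L : ℕ) (v : Fin m → ZMod p) (Y : Finset (Fin m)) {τ : ℝ}
    (hτ : 0 < τ) :
    ((Finset.univ.filter fun x => τ ≤ sumCount L v Y x).card : ℝ) ≤ (2 * m) ^ L / τ := by
  rw [le_div_iff₀ hτ]
  calc ((Finset.univ.filter fun x => τ ≤ sumCount L v Y x).card : ℝ) * τ
      = ∑ x ∈ Finset.univ.filter fun x => τ ≤ sumCount L v Y x, τ := by simp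
    _ ≤ ∑ x ∈ Finset.univ.filter fun x => τ ≤ sumCount L v Y x, (sumCount L v Y x : ℝ) :=
        Finset.sum_le_sum fun x hx => (Finset.mem_filter.1 hx).2
    _ ≤ ∑ x, (sumCount L v Y x : ℝ) :=
        Finset.sum_le_sum_of_subset_of_nonneg (Finset.subset_univ _) fun _ _ _ => by positivity
    _ ≤ (2 * m) ^ L := by
        unfold sumCount
        rw [← Nat.cast_sum, ← Finset.card_eq_sum_card_fiberwise (fun _ _ => Finset.mem_coe.2 (Finset.mem_univ _)),
          Fintype.card_piFinset]
        simp only [Finset.card_product, Finset.prod_const, Finset.card_univ, Fintype.card_bool,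
          Fintype.card_fin]
        push_cast
        have : (Y.card : ℝ) ≤ m := by
          exact_mod_cast (Finset.card_le_univ Y).trans_eq (Fintype.card_fin m)
        gcongr ?_ ^ L
        linarith

lemma two_pow_le_card_Icc {L : ℕ} {T U : Finset (Fin m)} (hTU : T ⊆ U) (hT : T.card ≤ L) :
    2 ^ U.card ≤ 2 ^ L * (Finset.Icc T U).card := by
  rw [Finset.card_Icc_finset hTU, ← pow_add]
  exact Nat.pow_le_pow_right (by norm_num) (by omega)

lemma sumCount_mul_two_pow_le (L : ℕ) (v : Fin m → ZMod p) (U : Finset (Fin m)) (x : ZMod p) :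
    sumCount L v U x * 2 ^ U.card ≤ 2 ^ L * ∑ Y ∈ U.powerset, sumCount L v Y x := by
  set A := (Fintype.piFinset fun _ : Fin L => U ×ˢ (Finset.univ : Finset Bool)).filter fun g =>
    ∑ q, ringSign (ZMod p) (g q).2 * v (g q).1 = x with hA
  let im : (Fin L → Fin m × Bool) → Finset (Fin m) := fun g => Finset.univ.image fun q => (g q).1
  have h1 : ∀ Y ∈ U.powerset, (A.filter fun g => im g ⊆ Y).card ≤ sumCount L v Y x := by
    intro Y _
    unfold sumCount
    refine Finset.card_le_card fun g hg => ?_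
    obtain ⟨hg1, hg2⟩ := Finset.mem_filter.1 hg
    refine Finset.mem_filter.2 ⟨?_, (Finset.mem_filter.1 hg1).2⟩
    rw [Fintype.mem_piFinset]
    intro q
    exact Finset.mem_product.2
      ⟨hg2 (Finset.mem_image_of_mem (fun q => (g q).1) (Finset.mem_univ q)), Finset.mem_univ _⟩
  have h2 : ∀ g ∈ A, 2 ^ U.card ≤ 2 ^ L * (U.powerset.filter fun Y => im g ⊆ Y).card := by
    intro g hg
    have hsub : im g ⊆ U := by
      intro i hi
      obtain ⟨q, -, rfl⟩ := Finset.mem_image.1 hi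
      exact (Finset.mem_product.1 (Fintype.mem_piFinset.1 (Finset.mem_filter.1 hg).1 q)).1
    have hc : (im g).card ≤ L := Finset.card_image_le.trans (by simp)
    refine (two_pow_le_card_Icc hsub hc).trans (Nat.mul_le_mul_left _ (Finset.card_le_card ?_))
    intro Y hY
    rw [Finset.mem_Icc] at hY
    exact Finset.mem_filter.2 ⟨Finset.mem_powerset.2 hY.2, hY.1⟩
  calc sumCount L v U x * 2 ^ U.card = ∑ g ∈ A, 2 ^ U.card := by
        rw [Finset.sum_const, smul_eq_mul]; rfl
    _ ≤ ∑ g ∈ A, 2 ^ L * (U.powerset.filter fun Y => im g ⊆ Y).card := Finset.sum_le_sum h2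
    _ = 2 ^ L * ∑ Y ∈ U.powerset, (A.filter fun g => im g ⊆ Y).card := by
        rw [← Finset.mul_sum]
        congr 1
        exact Finset.sum_card_bipartiteAbove_eq_sum_card_bipartiteBelow (fun g Y => im g ⊆ Y)
    _ ≤ _ := Nat.mul_le_mul_left _ (Finset.sum_le_sum h1)

lemma two_pow_le_card_good (L : ℕ) (v : Fin m → ZMod p) (U : Finset (Fin m)) (x : ZMod p) {τ : ℝ}
    (hτ0 : 0 < τ) (hτ : τ ≤ sumCount L v U x) :
    (2 : ℝ) ^ U.card ≤ 2 ^ (L + 1) *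
      (U.powerset.filter fun Y => τ / 2 ^ (L + 1) ≤ sumCount L v Y x).card := by
  set N : ℝ := ((sumCount L v U x : ℕ) : ℝ) with hN
  set G := U.powerset.filter fun Y => τ / 2 ^ (L + 1) ≤ sumCount L v Y x with hG
  have hN0 : 0 < N := hτ0.trans_le hτ
  have h1 : N * 2 ^ U.card ≤ 2 ^ L * ∑ Y ∈ U.powerset, (sumCount L v Y x : ℝ) := by
    rw [hN]
    exact_mod_cast sumCount_mul_two_pow_le L v U x
  have h2 : ∑ Y ∈ U.powerset, (sumCount L v Y x : ℝ) ≤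
      ∑ Y ∈ U.powerset, ((if Y ∈ G then N else 0) + N / 2 ^ (L + 1)) := by
    refine Finset.sum_le_sum fun Y hY => ?_
    have hpos : 0 ≤ N / 2 ^ (L + 1) := by positivity
    split_ifs with h
    · have : (sumCount L v Y x : ℝ) ≤ N := by
        rw [hN]
        exact_mod_cast sumCount_mono L v (Finset.mem_powerset.1 hY) x
      linarith
    · have : (sumCount L v Y x : ℝ) < τ / 2 ^ (L + 1) := by
        by_contra! hc
        exact h (Finset.mem_filter.2 ⟨hY, hc⟩)
      have h3 : τ / 2 ^ (L + 1) ≤ N / 2 ^ (L + 1) := by gcongr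
      linarith
  have h3 : ∑ Y ∈ U.powerset, ((if Y ∈ G then N else 0) + N / 2 ^ (L + 1)) =
      G.card * N + 2 ^ U.card * (N / 2 ^ (L + 1)) := by
    rw [Finset.sum_add_distrib, Finset.sum_const, Finset.card_powerset, Finset.sum_ite_mem,
      Finset.inter_eq_right.2 (Finset.filter_subset _ _), Finset.sum_const,
      nsmul_eq_mul, nsmul_eq_mul]
    push_cast
    rfl
  rw [h3] at h2
  have h4 : N * 2 ^ U.card ≤ 2 ^ L * (G.card * N + 2 ^ U.card * (N / 2 ^ (L + 1))) :=
    h1.trans (by gcongr)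
  have h5 : (2 : ℝ) ^ L * (G.card * N + 2 ^ U.card * (N / 2 ^ (L + 1))) =
      N * (2 ^ L * G.card + 2 ^ U.card / 2) := by
    field_simp
    ring
  rw [h5] at h4
  have h6 := le_of_mul_le_mul_left h4 hN0
  rw [pow_succ]
  linarith

/-- A random splitting of `U` leaves a positive proportion of the rich elements rich with respect
to the complementary part. -/
lemma exists_batch (L : ℕ) (v : Fin m → ZMod p) {U R : Finset (Fin m)} (hRU : R ⊆ U) {τ : ℝ}
    (hτ0 : 0 < τ) (hR : ∀ i ∈ R, τ ≤ sumCount L v (U.erase i) (v i)) :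
    ∃ Y ⊆ U, R.card ≤ 2 ^ (L + 2) *
      ((R \ Y).filter fun i => τ / 2 ^ (L + 1) ≤ sumCount L v Y (v i)).card := by
  let good : Fin m → Finset (Fin m) → Prop := fun i Y =>
    i ∉ Y ∧ τ / 2 ^ (L + 1) ≤ sumCount L v Y (v i)
  have h1 : ∀ i ∈ R, 2 ^ U.card ≤ 2 ^ (L + 2) * (U.powerset.filter fun Y => good i Y).card := by
    intro i hi
    have h := two_pow_le_card_good L v (U.erase i) (v i) hτ0 (hR i hi)
    have h' : 2 ^ (U.erase i).card ≤ 2 ^ (L + 1) * ((U.erase i).powerset.filter fun Y =>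
        τ / 2 ^ (L + 1) ≤ sumCount L v Y (v i)).card := by exact_mod_cast h
    have hc : U.card = (U.erase i).card + 1 := (Finset.card_erase_add_one (hRU hi)).symm
    have hsub : ((U.erase i).powerset.filter fun Y => τ / 2 ^ (L + 1) ≤ sumCount L v Y (v i)).card ≤
        (U.powerset.filter fun Y => good i Y).card := by
      refine Finset.card_le_card fun Y hY => ?_
      obtain ⟨hY1, hY2⟩ := Finset.mem_filter.1 hY
      rw [Finset.mem_powerset] at hY1
      exact Finset.mem_filter.2 ⟨Finset.mem_powerset.2 (hY1.trans (Finset.erase_subset _ _)),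
        fun h => (Finset.mem_erase.1 (hY1 h)).1 rfl, hY2⟩
    calc 2 ^ U.card = 2 * 2 ^ (U.erase i).card := by rw [hc]; ring
      _ ≤ 2 * (2 ^ (L + 1) * (U.powerset.filter fun Y => good i Y).card) := by
          gcongr; exact h'.trans (by gcongr)
      _ = _ := by ring
  have h2 : ∑ Y ∈ U.powerset, R.card ≤
      ∑ Y ∈ U.powerset, 2 ^ (L + 2) * (R.filter fun i => good i Y).card := by
    have hswap : ∑ Y ∈ U.powerset, (R.filter fun i => good i Y).card =
        ∑ i ∈ R, (U.powerset.filter fun Y => good i Y).card :=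
      (Finset.sum_card_bipartiteAbove_eq_sum_card_bipartiteBelow (fun i Y => good i Y)).symm
    rw [← Finset.mul_sum, hswap, Finset.mul_sum, Finset.sum_const, Finset.card_powerset, smul_eq_mul, mul_comm, ← smul_eq_mul,
      ← Finset.sum_const]
    exact Finset.sum_le_sum h1
  obtain ⟨Y, hY, hle⟩ := Finset.exists_le_of_sum_le (Finset.powerset_nonempty U) h2
  refine ⟨Y, Finset.mem_powerset.1 hY, hle.trans_eq ?_⟩
  congr 2
  ext i
  simp [good, and_assoc]

/-- Vectors supported in `U` all of whose `s`-element subfamilies contain an element which is in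
at least `τ` ways an `L`-term signed sum of the others. -/
def richVectors (p : ℕ) [NeZero p] {m : ℕ} (L s : ℕ) (τ : ℝ) (U : Finset (Fin m)) :
    Finset (Fin m → ZMod p) :=
  Finset.univ.filter fun v => (∀ i, i ∉ U → v i = 0) ∧
    ∀ P ⊆ U, P.card = s → ∃ i ∈ P, τ ≤ sumCount L v (P.erase i) (v i)

lemma richVectors_subset [NeZero p] {L s : ℕ} {τ : ℝ} (hτ0 : 0 < τ) {U : Finset (Fin m)}
    (hU : 2 * s < U.card) :
    richVectors p L s τ U ⊆
      (U.powerset.filter fun b => U.card ≤ 2 ^ (L + 3) * b.card).biUnion fun b =>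
        (richVectors p L s τ (U \ b)).biUnion fun w => Fintype.piFinset fun i =>
          if i ∈ b then Finset.univ.filter fun x => τ / 2 ^ (L + 1) ≤ sumCount L w (U \ b) x
          else {w i} := by
  intro v hv
  obtain ⟨-, hv1, hv2⟩ := Finset.mem_filter.1 hv
  set R := U.filter fun i => τ ≤ sumCount L v (U.erase i) (v i) with hRdef
  have hRU : R ⊆ U := Finset.filter_subset _ _
  have hRc : U.card ≤ 2 * R.card := by
    have h1 : (U \ R).card < s := by
      by_contra! hcon
      obtain ⟨P, hPs, hPc⟩ := Finset.exists_subset_card_eq hcon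
      obtain ⟨i, hi, hle⟩ := hv2 P (hPs.trans Finset.sdiff_subset) hPc
      have hiU := Finset.mem_sdiff.1 (hPs hi)
      refine hiU.2 (Finset.mem_filter.2 ⟨hiU.1, hle.trans ?_⟩)
      exact_mod_cast sumCount_mono L v
        (Finset.erase_subset_erase i (hPs.trans Finset.sdiff_subset)) (v i)
    have h2 := Finset.card_sdiff_add_card_eq_card hRU
    omega
  obtain ⟨Y, hYU, hY⟩ := exists_batch L v hRU hτ0 fun i hi => (Finset.mem_filter.1 hi).2
  set b := (R \ Y).filter fun i => τ / 2 ^ (L + 1) ≤ sumCount L v Y (v i) with hb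
  have hbU : b ⊆ U := (Finset.filter_subset _ _).trans (Finset.sdiff_subset.trans hRU)
  have hYb : Y ⊆ U \ b := fun i hi => Finset.mem_sdiff.2 ⟨hYU hi, fun hib =>
    (Finset.mem_sdiff.1 (Finset.mem_filter.1 hib).1).2 hi⟩
  have hw : ∀ i ∈ U \ b, v i = (fun i => if i ∈ U \ b then v i else 0) i := fun i hi => by
    simp only [if_pos hi]
  refine Finset.mem_biUnion.2 ⟨b, Finset.mem_filter.2 ⟨Finset.mem_powerset.2 hbU, ?_⟩,
    Finset.mem_biUnion.2 ⟨fun i => if i ∈ U \ b then v i else 0, ?_, ?_⟩⟩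
  · calc U.card ≤ 2 * R.card := hRc
      _ ≤ 2 * (2 ^ (L + 2) * b.card) := by gcongr
      _ = _ := by ring
  · refine Finset.mem_filter.2 ⟨Finset.mem_univ _, fun i hi => if_neg hi, fun P hP hPc => ?_⟩
    obtain ⟨i, hi, hle⟩ := hv2 P (hP.trans Finset.sdiff_subset) hPc
    refine ⟨i, hi, ?_⟩
    rw [← sumCount_congr L fun j hj => hw j (hP (Finset.erase_subset _ _ hj)), ← hw i (hP hi)]
    exact hle
  · rw [Fintype.mem_piFinset]
    intro i
    split_ifs with hib
    · refine Finset.mem_filter.2 ⟨Finset.mem_univ _, ?_⟩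
      rw [← sumCount_congr L hw]
      refine (Finset.mem_filter.1 hib).2.trans ?_
      exact_mod_cast sumCount_mono L v hYb (v i)
    · simp only [Finset.mem_singleton, Finset.mem_sdiff]
      split_ifs with hiU
      · rfl
      · exact hv1 i fun h => hiU ⟨h, hib⟩

/-- Inverse Littlewood–Offord counting bound. -/
lemma card_richVectors_le [NeZero p] {L s : ℕ} {τ D : ℝ} (hτ0 : 0 < τ)
    (hD : (2 * m) ^ L * 2 ^ (L + 1) / τ ≤ D) (hD1 : 1 ≤ D) (U : Finset (Fin m)) :
    ((richVectors p L s τ U).card : ℝ) ≤ p ^ (2 * s) * (2 ^ 2 ^ (L + 3) * D) ^ U.card := by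
  induction hn : U.card using Nat.strong_induction_on generalizing U with
  | _ n ih =>
  subst hn
  have hp1 : (1 : ℝ) ≤ p := by exact_mod_cast Nat.one_le_iff_ne_zero.2 (NeZero.ne p)
  set B : ℝ := 2 ^ 2 ^ (L + 3) with hB
  have hB1 : 1 ≤ B := one_le_pow₀ (by norm_num)
  rcases le_or_gt U.card (2 * s) with hU | hU
  · have h1 : (richVectors p L s τ U).card ≤ p ^ U.card := by
      have : richVectors p L s τ U ⊆ Fintype.piFinset fun i => if i ∈ U then Finset.univ else {0} := by
        intro v hv
        obtain ⟨-, hv1, -⟩ := Finset.mem_filter.1 hv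
        rw [Fintype.mem_piFinset]
        intro i
        split_ifs with h
        · exact Finset.mem_univ _
        · exact Finset.mem_singleton.2 (hv1 i h)
      refine (Finset.card_le_card this).trans_eq ?_
      rw [Fintype.card_piFinset]
      simp only [apply_ite Finset.card, Finset.card_univ, ZMod.card, Finset.card_singleton]
      rw [Finset.prod_ite_mem, Finset.univ_inter, Finset.prod_const]
    calc ((richVectors p L s τ U).card : ℝ) ≤ p ^ U.card := by exact_mod_cast h1
      _ ≤ p ^ (2 * s) := pow_le_pow_right₀ hp1 hU
      _ ≤ _ := le_mul_of_one_le_right (by positivity) (one_le_pow₀ (one_le_mul_of_one_le_of_one_le hB1 hD1))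
  · have hfib : ∀ b ⊆ U, ∀ w : Fin m → ZMod p, ((Fintype.piFinset fun i =>
          if i ∈ b then Finset.univ.filter fun x => τ / 2 ^ (L + 1) ≤ sumCount L w (U \ b) x
          else {w i}).card : ℝ) ≤ D ^ b.card := by
      intro b hb w
      rw [Fintype.card_piFinset]
      simp only [apply_ite Finset.card, Finset.card_singleton]
      rw [Finset.prod_ite_mem, Finset.univ_inter, Finset.prod_const]
      push_cast
      gcongr
      refine (card_frequent_values_le L w (U \ b) (by positivity)).trans (le_trans (le_of_eq ?_) hD)
      field_simp
    have h1 := Finset.card_le_card (richVectors_subset (p := p) (L := L) (s := s) hτ0 hU)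
    have h2 : ((richVectors p L s τ U).card : ℝ) ≤
        ∑ b ∈ U.powerset.filter (fun b => U.card ≤ 2 ^ (L + 3) * b.card),
          ((richVectors p L s τ (U \ b)).card : ℝ) * D ^ b.card := by
      refine (Nat.cast_le.2 (h1.trans Finset.card_biUnion_le)).trans ?_
      rw [Nat.cast_sum]
      refine Finset.sum_le_sum fun b hb => ?_
      refine (Nat.cast_le.2 Finset.card_biUnion_le).trans ?_
      rw [Nat.cast_sum, ← nsmul_eq_mul, ← Finset.sum_const]
      exact Finset.sum_le_sum fun w _ =>
        hfib b (Finset.mem_powerset.1 (Finset.mem_filter.1 hb).1) w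
    have h3 : ∀ b ∈ U.powerset.filter (fun b => U.card ≤ 2 ^ (L + 3) * b.card),
        ((richVectors p L s τ (U \ b)).card : ℝ) * D ^ b.card ≤
          p ^ (2 * s) * (B * D) ^ U.card / 2 ^ U.card := by
      intro b hb
      obtain ⟨hbU, hbc⟩ := Finset.mem_filter.1 hb
      rw [Finset.mem_powerset] at hbU
      have hbpos : 0 < b.card := by
        by_contra! h0
        have : b.card = 0 := by omega
        rw [this] at hbc
        omega
      have hcard := Finset.card_sdiff_add_card_eq_card hbU
      have h4 := ih _ (by omega) (U \ b) rfl
      have h5 : (2 : ℝ) ^ U.card ≤ B ^ b.card := by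
        rw [hB, ← pow_mul]
        exact pow_le_pow_right₀ (by norm_num) hbc
      rw [le_div_iff₀ (by positivity)]
      calc ((richVectors p L s τ (U \ b)).card : ℝ) * D ^ b.card * 2 ^ U.card
          ≤ p ^ (2 * s) * (B * D) ^ (U \ b).card * D ^ b.card * B ^ b.card := by gcongr
        _ = p ^ (2 * s) * (B * D) ^ ((U \ b).card + b.card) := by ring
        _ = _ := by rw [hcard]
    refine (h2.trans (Finset.sum_le_sum h3)).trans ?_
    rw [Finset.sum_const, nsmul_eq_mul]
    have h6 : (((U.powerset.filter (fun b => U.card ≤ 2 ^ (L + 3) * b.card)).card : ℕ) : ℝ) ≤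
        2 ^ U.card := by
      exact_mod_cast (Finset.card_filter_le _ _).trans_eq (Finset.card_powerset U)
    calc _ ≤ 2 ^ U.card * (p ^ (2 * s) * (B * D) ^ U.card / 2 ^ U.card) := by gcongr
      _ = _ := by field_simp

end Counting

section SymmetricSigns

variable {m : ℕ}

/-- The symmetric sign matrix over a ring determined by the bits on and above the diagonal. -/
def signMatrix (R : Type*) [Ring R] (h : Fin m → Fin m → Bool) : Matrix (Fin m) (Fin m) R :=
  Matrix.of fun i j => if i ≤ j then ringSign R (h i j) else ringSign R (h j i)

/-- Exchange the bits of `h` governing the block `Sᶜ × S` with the corresponding bits of `k`. -/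
def swapBlock (S : Finset (Fin m)) (x : (Fin m → Fin m → Bool) × (Fin m → Fin m → Bool)) :
    (Fin m → Fin m → Bool) × (Fin m → Fin m → Bool) :=
  (fun a b => if a ≤ b then
      if a ∉ S ∧ b ∈ S then x.2 a b else if a ∈ S ∧ b ∉ S then x.2 b a else x.1 a b
    else x.1 a b,
   fun i j => if i ∉ S ∧ j ∈ S then if i ≤ j then x.1 i j else x.1 j i else x.2 i j)

lemma swapBlock_involutive (S : Finset (Fin m)) : Function.Involutive (swapBlock S) := by
  rintro ⟨h, k⟩
  refine Prod.ext ?_ ?_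
  · funext a b
    by_cases hab : a ≤ b
    · by_cases ha : a ∈ S <;> by_cases hb : b ∈ S
      · simp [swapBlock, ha, hb]
      · have hne : ¬ b ≤ a := fun h' => hb (le_antisymm hab h' ▸ ha)
        simp [swapBlock, ha, hb, hab, hne]
      · simp [swapBlock, ha, hb, hab]
      · simp [swapBlock, ha, hb]
    · simp [swapBlock, hab]
  · funext i j
    by_cases hi : i ∈ S
    · simp [swapBlock, hi]
    · by_cases hj : j ∈ S
      · by_cases hij : i ≤ j
        · simp [swapBlock, hi, hj, hij]
        · simp [swapBlock, hi, hj, hij, (le_total i j).resolve_left hij]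
      · simp [swapBlock, hj]

lemma signMatrix_swapBlock (R : Type*) [Ring R] (S : Finset (Fin m))
    (h k : Fin m → Fin m → Bool) {i : Fin m} (hi : i ∉ S) (j : Fin m) :
    signMatrix R (swapBlock S (h, k)).1 i j =
      if j ∈ S then ringSign R (k i j) else signMatrix R h i j := by
  by_cases hj : j ∈ S
  · by_cases hij : i ≤ j
    · simp [signMatrix, swapBlock, hi, hj, hij]
    · simp [signMatrix, swapBlock, hi, hj, hij, (le_total i j).resolve_left hij]
  · simp [signMatrix, swapBlock, hi, hj]

lemma card_signMatrix_mulVec_le {R : Type*} [Ring R] [DecidableEq R] (S : Finset (Fin m)) (v u : Fin m → R) {q : ℝ}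
    (hq : ∀ x, ((Finset.univ.filter fun ξ : Fin m → Bool =>
      ∑ j ∈ S, ringSign R (ξ j) * v j = x).card : ℝ) ≤ q * 2 ^ m) :
    ((Finset.univ.filter fun h : Fin m → Fin m → Bool => (signMatrix R h).mulVec v = u).card : ℝ) ≤
      q ^ (m - S.card) * 2 ^ (m * m) := by
  set E := Finset.univ.filter fun h : Fin m → Fin m → Bool => (signMatrix R h).mulVec v = u with hE
  have hcardB : Fintype.card (Fin m → Fin m → Bool) = 2 ^ (m * m) := by
    simp [← pow_mul]
  have h1 : E.card * 2 ^ (m * m) = ∑ h : Fin m → Fin m → Bool,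
      (Finset.univ.filter fun k => (swapBlock S (h, k)).1 ∈ E).card := by
    have e1 : E.card * 2 ^ (m * m) = (E ×ˢ (Finset.univ : Finset (Fin m → Fin m → Bool))).card := by
      rw [Finset.card_product, Finset.card_univ, hcardB]
    have e2 : (E ×ˢ (Finset.univ : Finset (Fin m → Fin m → Bool))).card =
        (Finset.univ.filter fun x => (swapBlock S x).1 ∈ E).card := by
      refine (Finset.card_equiv (swapBlock_involutive S).toPerm fun x => ?_).symm
      simp
    rw [e1, e2, ← Finset.univ_product_univ,
      Finset.card_filter, Finset.sum_product]
    simp only [Finset.card_filter]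
  have h2 : ∀ h : Fin m → Fin m → Bool,
      ((Finset.univ.filter fun k => (swapBlock S (h, k)).1 ∈ E).card : ℝ) ≤
        q ^ (m - S.card) * 2 ^ (m * m) := by
    intro h
    let x : Fin m → R := fun i => u i - ∑ j ∈ Sᶜ, signMatrix R h i j * v j
    have hsub : (Finset.univ.filter fun k => (swapBlock S (h, k)).1 ∈ E) ⊆
        Fintype.piFinset fun i => if i ∈ Sᶜ then
          Finset.univ.filter fun ξ : Fin m → Bool => ∑ j ∈ S, ringSign R (ξ j) * v j = x i
          else Finset.univ := by
      intro k hk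
      rw [Fintype.mem_piFinset]
      intro i
      split_ifs with hi
      · rw [Finset.mem_compl] at hi
        refine Finset.mem_filter.2 ⟨Finset.mem_univ _, ?_⟩
        have hrow := congrFun (Finset.mem_filter.1 (Finset.mem_filter.1 hk).2).2 i
        rw [Matrix.mulVec, dotProduct, ← Finset.sum_add_sum_compl S] at hrow
        change _ = u i - _
        have e1 : ∑ j ∈ S, signMatrix R (swapBlock S (h, k)).1 i j * v j =
            ∑ j ∈ S, ringSign R (k i j) * v j :=
          Finset.sum_congr rfl fun j hj => by rw [signMatrix_swapBlock R S h k hi, if_pos hj]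
        have e2 : ∑ j ∈ Sᶜ, signMatrix R (swapBlock S (h, k)).1 i j * v j =
            ∑ j ∈ Sᶜ, signMatrix R h i j * v j :=
          Finset.sum_congr rfl fun j hj => by
            rw [signMatrix_swapBlock R S h k hi, if_neg (Finset.mem_compl.1 hj)]
        rw [← e1, ← e2, ← hrow, add_sub_cancel_right]
      · exact Finset.mem_univ _
    have hle : ((Finset.univ.filter fun k => (swapBlock S (h, k)).1 ∈ E).card : ℝ) ≤
        ∏ i : Fin m, ((if i ∈ Sᶜ then q else 1) * 2 ^ m) := by
      refine (Nat.cast_le.2 (Finset.card_le_card hsub)).trans ?_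
      rw [Fintype.card_piFinset, Nat.cast_prod]
      refine Finset.prod_le_prod (fun _ _ => Nat.cast_nonneg _) fun i _ => ?_
      split_ifs with hi
      · exact hq (x i)
      · simp
    refine hle.trans_eq ?_
    rw [Finset.prod_mul_distrib, Finset.prod_ite_mem, Finset.univ_inter, Finset.prod_const,
      Finset.prod_const, Finset.card_compl, Finset.card_univ, Fintype.card_fin, ← pow_mul]
  have h3 : (E.card : ℝ) * 2 ^ (m * m) ≤ (q ^ (m - S.card) * 2 ^ (m * m)) * 2 ^ (m * m) := by
    have : (E.card : ℝ) * 2 ^ (m * m) = ∑ h : Fin m → Fin m → Bool,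
      ((Finset.univ.filter fun k => (swapBlock S (h, k)).1 ∈ E).card : ℝ) := by exact_mod_cast h1
    rw [this]
    refine (Finset.sum_le_sum fun h _ => h2 h).trans_eq ?_
    rw [Finset.sum_const, Finset.card_univ, hcardB, nsmul_eq_mul]
    push_cast
    ring
  exact le_of_mul_le_mul_right h3 (by positivity)

lemma card_signMatrix_mulVec_le_conc {p : ℕ} [Fact p.Prime] (hp2 : p ≠ 2) (S : Finset (Fin m))
    (v u : Fin m → ZMod p) :
    ((Finset.univ.filter fun h : Fin m → Fin m → Bool =>
      (signMatrix (ZMod p) h).mulVec v = u).card : ℝ) ≤ conc v S ^ (m - S.card) * 2 ^ (m * m) :=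
  card_signMatrix_mulVec_le S v u fun x => card_signed_sum_le hp2 v S x

lemma card_signMatrix_mulVec_le_half {p : ℕ} [Fact p.Prime] (hp2 : p ≠ 2) {v : Fin m → ZMod p}
    (hv : v ≠ 0) (u : Fin m → ZMod p) :
    ((Finset.univ.filter fun h : Fin m → Fin m → Bool =>
      (signMatrix (ZMod p) h).mulVec v = u).card : ℝ) ≤ (1 / 2) ^ (m - 1) * 2 ^ (m * m) := by
  obtain ⟨i, hi⟩ := Function.ne_iff.1 hv
  have h := card_signMatrix_mulVec_le {i} v u (q := 1 / 2) fun x => ?_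
  · rwa [Finset.card_singleton] at h
  simp only [Finset.sum_singleton]
  set A := Finset.univ.filter fun ξ : Fin m → Bool => ringSign (ZMod p) (ξ i) * v i = x with hA
  let flip : (Fin m → Bool) → (Fin m → Bool) := fun ξ => Function.update ξ i (!ξ i)
  have hinv : Function.Involutive flip := fun ξ => by
    funext j
    by_cases hj : j = i
    · subst hj; simp [flip]
    · simp [flip, hj]
  have h2 : (2 : ZMod p) ≠ 0 := by
    intro h0
    have : (p : ℕ) ∣ 2 := (ZMod.natCast_eq_zero_iff 2 p).1 (by exact_mod_cast h0)
    exact hp2 ((Nat.prime_dvd_prime_iff_eq Fact.out Nat.prime_two).1 this)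
  have hdisj : Disjoint A (A.image flip) := by
    rw [Finset.disjoint_left]
    rintro ξ h1 h3
    obtain ⟨η, hη, rfl⟩ := Finset.mem_image.1 h3
    have e1 := (Finset.mem_filter.1 h1).2
    have e2 := (Finset.mem_filter.1 hη).2
    simp only [flip, Function.update_self, ringSign_not] at e1
    have : (2 : ZMod p) * (ringSign (ZMod p) (η i) * v i) = 0 := by linear_combination e2 - e1
    rcases mul_eq_zero.1 this with h | h
    · exact h2 h
    · rcases mul_eq_zero.1 h with h | h
      · cases hb : η i <;> simp [ringSign, hb] at h
      · exact hi h
  have hc := Finset.card_le_univ (A ∪ A.image flip)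
  rw [Finset.card_union_of_disjoint hdisj, Finset.card_image_of_injective _ hinv.injective] at hc
  have : Fintype.card (Fin m → Bool) = 2 ^ m := by simp
  rw [this] at hc
  have hc' : (A.card : ℝ) + A.card ≤ 2 ^ m := by exact_mod_cast hc
  linarith

end SymmetricSigns

section Structured

variable {p m : ℕ}

lemma card_sparse_le [NeZero p] {r : ℕ} (hr : r ≤ m) :
    (Finset.univ.filter fun v : Fin m → ZMod p =>
      (Finset.univ.filter fun i => v i ≠ 0).card ≤ r).card ≤ m ^ r * p ^ r := by
  have hsub : (Finset.univ.filter fun v : Fin m → ZMod p =>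
      (Finset.univ.filter fun i => v i ≠ 0).card ≤ r) ⊆
      (Finset.univ.powersetCard r).biUnion fun T : Finset (Fin m) =>
        Fintype.piFinset fun i => if i ∈ T then Finset.univ else {0} := by
    intro v hv
    obtain ⟨T, hT, hTc⟩ := Finset.exists_superset_card_eq (Finset.mem_filter.1 hv).2
      (by simpa using hr)
    refine Finset.mem_biUnion.2 ⟨T, Finset.mem_powersetCard.2 ⟨Finset.subset_univ _, hTc⟩, ?_⟩
    rw [Fintype.mem_piFinset]
    intro i
    split_ifs with hi
    · exact Finset.mem_univ _
    · rw [Finset.mem_singleton]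
      by_contra h
      exact hi (hT (Finset.mem_filter.2 ⟨Finset.mem_univ _, h⟩))
  refine (Finset.card_le_card hsub).trans (Finset.card_biUnion_le.trans ?_)
  have : ∀ T ∈ (Finset.univ : Finset (Fin m)).powersetCard r,
      (Fintype.piFinset fun i => if i ∈ T then (Finset.univ : Finset (ZMod p)) else {0}).card =
        p ^ r := by
    intro T hT
    rw [Fintype.card_piFinset]
    simp only [apply_ite Finset.card, Finset.card_univ, ZMod.card, Finset.card_singleton]
    rw [Finset.prod_ite_mem, Finset.univ_inter, Finset.prod_const, (Finset.mem_powersetCard.1 hT).2]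
  rw [Finset.sum_congr rfl this, Finset.sum_const, Finset.card_powersetCard, Finset.card_univ,
    Fintype.card_fin, smul_eq_mul]
  exact Nat.mul_le_mul_right _ (Nat.choose_le_pow _ _)

lemma exists_level [NeZero p] {v : Fin m → ZMod p} {I U : Finset (Fin m)} {β : ℝ} {s : ℕ}
    (hβ : 0 < β) (hβm : (1 / 2) ^ m < β) (hv : β ≤ conc v I) (hU : U ⊆ I) (hs : s ≤ U.card) :
    ∃ j ∈ Finset.range m, β ≤ (1 / 2) ^ j ∧ (∃ P, conc v P ≤ (1 / 2) ^ j ∧ P.card = s) ∧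
      ∀ P ⊆ U, P.card = s → (1 / 2) ^ (j + 1) ≤ conc v P := by
  obtain ⟨P, hP, hmin⟩ := Finset.exists_min_image (U.powersetCard s) (conc v)
    (Finset.powersetCard_nonempty.2 hs)
  rw [Finset.mem_powersetCard] at hP
  have hβP : β ≤ conc v P := hv.trans (conc_anti v (hP.1.trans hU))
  obtain ⟨j, hj1, hj2⟩ := exists_nat_pow_near_of_lt_one (hβ.trans_le hβP) (conc_le_one v P)
    (y := (1 / 2 : ℝ)) (by norm_num) (by norm_num)
  refine ⟨j, ?_, hβP.trans hj2, ⟨P, hj2, hP.2⟩, fun Q hQ hQs =>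
    hj1.le.trans (hmin Q (Finset.mem_powersetCard.2 ⟨hQ, hQs⟩))⟩
  rw [Finset.mem_range]
  by_contra! hmj
  have : (1 / 2 : ℝ) ^ j ≤ (1 / 2) ^ m := pow_le_pow_of_le_one (by norm_num) (by norm_num) hmj
  linarith

lemma card_level_le [Fact p.Prime] {J U : Finset (Fin m)} {β ρ t : ℝ} {s k l L : ℕ} (hl : 0 < l)
    (hL : L + 1 = 2 * l) (hs : 0 < s) (hJ : J.card = s) (hβ : 0 < β) (ht0 : 0 ≤ t)
    (hβp : 8 ≤ β * p) (hexp : Real.exp (-(t / 2)) ≤ β / 8) (hkt : 4 ^ k * t ≤ (s : ℝ) / 16)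
    (htriv : 16 * (2 * l : ℝ) ^ (2 * l) ≤ β * s ^ l) (hρ : β / 2 ≤ ρ)
    (hU : U ⊆ Jᶜ) (hsU : s ≤ U.card) :
    ((Finset.univ.filter fun v : Fin m → ZMod p => (∀ i ∈ Jᶜ, v i ≠ 0 ↔ i ∈ U) ∧
      ∀ P ⊆ U, P.card = s → ρ ≤ conc v P).card : ℝ) ≤
      p ^ (3 * s) *
        (2 ^ 2 ^ (L + 3) * ((2 * m) ^ L * 2 ^ (L + 1) * (32 * l) / (2 ^ k * s ^ L) / ρ)) ^ m := by
  have hρ0 : 0 < ρ := by linarith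
  have hsR : (0 : ℝ) < s := by exact_mod_cast hs
  have hlR : (0 : ℝ) < l := by exact_mod_cast hl
  have hpR : (0 : ℝ) < p := by exact_mod_cast (Fact.out : p.Prime).pos
  set D : ℝ := (2 * m) ^ L * 2 ^ (L + 1) * (32 * l) / (2 ^ k * s ^ L) / ρ with hD
  set τ : ℝ := 2 ^ k * ρ * s ^ L / (32 * l) with hτ
  set V := Finset.univ.filter fun v : Fin m → ZMod p => (∀ i ∈ Jᶜ, v i ≠ 0 ↔ i ∈ U) ∧
      ∀ P ⊆ U, P.card = s → ρ ≤ conc v P with hV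
  have hτ0 : 0 < τ := by positivity
  have hDτ : (2 * (m : ℝ)) ^ L * 2 ^ (L + 1) / τ = D := by
    rw [hD, hτ]; field_simp
  have hrich : ∀ v ∈ V, (fun i => if i ∈ U then v i else 0) ∈ richVectors p L s τ U := by
    intro v hv
    obtain ⟨-, hv1, hv2⟩ := Finset.mem_filter.1 hv
    refine Finset.mem_filter.2 ⟨Finset.mem_univ _, fun i hi => if_neg hi, fun P hP hPs => ?_⟩
    have hw : ∀ i ∈ P, v i = (fun i => if i ∈ U then v i else 0) i := fun i hi => by
      simp only [if_pos (hP hi)]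
    have hne : ∀ i ∈ P, (fun i => if i ∈ U then v i else 0) i ≠ 0 := fun i hi => by
      rw [← hw i hi]
      exact (hv1 i (hU (hP hi))).2 (hP hi)
    have h1 := sumCount_zero_ge hne k l ht0 ((conc_congr hw).symm ▸ hv2 P hP hPs) ?_
      (hexp.trans (by linarith)) (by rwa [hPs]) (by rwa [hPs])
    · refine exists_rich hl hL _ (Finset.card_pos.1 (by omega)) (le_trans ?_ h1)
      rw [hPs]
      have e1 : 4 * l * s * τ = 2 ^ k * ρ * s ^ (2 * l) / 8 := by
        rw [hτ, ← hL, pow_succ]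
        field_simp
        ring
      have e2 : (l : ℝ) ^ (2 * l) * s ^ l * 2 ^ (2 * l) ≤ 2 ^ k * ρ * s ^ (2 * l) / 8 := by
        have hk1 : (1 : ℝ) ≤ 2 ^ k := one_le_pow₀ (by norm_num)
        calc (l : ℝ) ^ (2 * l) * s ^ l * 2 ^ (2 * l)
            = (16 * (2 * l : ℝ) ^ (2 * l)) * s ^ l / 16 := by rw [mul_pow]; ring
          _ ≤ (β * s ^ l) * s ^ l / 16 := by gcongr
          _ = (β / 2) * s ^ (2 * l) / 8 := by rw [two_mul l, pow_add]; ring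
          _ ≤ (2 ^ k * ρ) * s ^ (2 * l) / 8 := by
              gcongr
              exact hρ.trans (le_mul_of_one_le_left hρ0.le hk1)
      linarith
    · nlinarith
  rcases V.eq_empty_or_nonempty with hVe | ⟨v0, hv0⟩
  · rw [hVe, Finset.card_empty, Nat.cast_zero]
    positivity
  have hD1 : 1 ≤ D := by
    obtain ⟨-, -, h2⟩ := Finset.mem_filter.1 (hrich v0 hv0)
    obtain ⟨P, hPU, hPs⟩ := Finset.exists_subset_card_eq hsU
    obtain ⟨i, -, hi⟩ := h2 P hPU hPs
    have h3 : τ ≤ (2 * (m : ℝ)) ^ L := hi.trans (by exact_mod_cast sumCount_le L _ _ _)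
    rw [← hDτ, le_div_iff₀ hτ0, one_mul]
    exact h3.trans (le_mul_of_one_le_right (by positivity) (one_le_pow₀ (by norm_num)))
  have hB1 : (1 : ℝ) ≤ 2 ^ 2 ^ (L + 3) := one_le_pow₀ (by norm_num)
  have hcount : V.card ≤ (richVectors p L s τ U).card * p ^ s := by
    have hpi : (Fintype.piFinset fun i => if i ∈ J then (Finset.univ : Finset (ZMod p)) else {0}).card
        = p ^ s := by
      rw [Fintype.card_piFinset]
      simp only [apply_ite Finset.card, Finset.card_univ, ZMod.card, Finset.card_singleton]
      rw [Finset.prod_ite_mem, Finset.univ_inter, Finset.prod_const, hJ]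
    rw [← hpi, ← Finset.card_product]
    refine Finset.card_le_card_of_injOn
      (fun v => ((fun i => if i ∈ U then v i else 0), fun i => if i ∈ J then v i else 0)) ?_ ?_
    · intro v hv
      refine Finset.mem_coe.2 (Finset.mem_product.2 ⟨hrich v hv, ?_⟩)
      rw [Fintype.mem_piFinset]
      intro i
      by_cases hi : i ∈ J <;> simp [hi]
    · intro v hv w hw hvw
      rw [Prod.mk.injEq] at hvw
      funext i
      have h1 := congrFun hvw.1 i
      have h2 := congrFun hvw.2 i
      by_cases hiJ : i ∈ J
      · simpa [hiJ] using h2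
      · by_cases hiU : i ∈ U
        · simpa [hiU] using h1
        · have hv' := (Finset.mem_filter.1 hv).2.1 i (Finset.mem_compl.2 hiJ)
          have hw' := (Finset.mem_filter.1 hw).2.1 i (Finset.mem_compl.2 hiJ)
          rw [not_not.1 fun h => hiU (hv'.1 h), not_not.1 fun h => hiU (hw'.1 h)]
  calc (V.card : ℝ) ≤ (richVectors p L s τ U).card * p ^ s := by exact_mod_cast hcount
    _ ≤ p ^ (2 * s) * (2 ^ 2 ^ (L + 3) * D) ^ U.card * p ^ s := by
        gcongr
        exact card_richVectors_le hτ0 hDτ.le hD1 U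
    _ = p ^ (3 * s) * (2 ^ 2 ^ (L + 3) * D) ^ U.card := by ring
    _ ≤ _ := by
        gcongr
        · exact one_le_mul_of_one_le_of_one_le hB1 hD1
        · exact (Finset.card_le_univ U).trans_eq (Fintype.card_fin m)

/-- Sign matrices admitting a nonzero vector of large concentration which they map to a multiple
of `w`. -/
def badMatrices (p : ℕ) [NeZero p] {m : ℕ} (J : Finset (Fin m)) (β : ℝ) (w : Fin m → ZMod p) :
    Finset (Fin m → Fin m → Bool) :=
  Finset.univ.filter fun h => ∃ v : Fin m → ZMod p, v ≠ 0 ∧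
    (∃ t : ZMod p, (signMatrix (ZMod p) h).mulVec v = t • w) ∧ β ≤ conc v Jᶜ

lemma card_badMatrices_le [Fact p.Prime] (hp2 : p ≠ 2) {J : Finset (Fin m)} {β t : ℝ}
    {s k l L : ℕ} (hl : 0 < l)
    (hL : L + 1 = 2 * l) (hs : 0 < s) (hJ : J.card = s) (hβ : 0 < β) (ht0 : 0 ≤ t)
    (hβp : 8 ≤ β * p) (hexp : Real.exp (-(t / 2)) ≤ β / 8) (hkt : 4 ^ k * t ≤ (s : ℝ) / 16)
    (htriv : 16 * (2 * l : ℝ) ^ (2 * l) ≤ β * s ^ l) (hsm : 3 * s ≤ m) (hmp : m ≤ p)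
    (hβm : (1 / 2) ^ m < β)
    (hk : 2 ^ 2 ^ (L + 3) * ((2 * m) ^ L * 2 ^ (L + 1) * (32 * l) / (2 ^ k * (s : ℝ) ^ L)) ≤ 1 / 16)
    (w : Fin m → ZMod p) :
    ((badMatrices p J β w).card : ℝ) ≤ 3 * p ^ (6 * s + 1) / 2 ^ m * 2 ^ (m * m) := by
  have hp1 : (1 : ℝ) ≤ p := by exact_mod_cast (Fact.out : p.Prime).one_lt.le
  have hp0 : (0 : ℝ) < p := by linarith
  have hm1 : 0 < m := by omega
  let ev : ZMod p → (Fin m → ZMod p) → Finset (Fin m → Fin m → Bool) := fun t v =>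
    Finset.univ.filter fun h => (signMatrix (ZMod p) h).mulVec v = t • w
  let sp : Finset (Fin m → ZMod p) := Finset.univ.filter fun v =>
    (Finset.univ.filter fun i => v i ≠ 0).card ≤ 3 * s
  let lev : ℕ → Finset (Fin m) → Finset (Fin m → ZMod p) := fun j U => Finset.univ.filter fun v =>
    (∀ i ∈ Jᶜ, v i ≠ 0 ↔ i ∈ U) ∧ ∀ P ⊆ U, P.card = s → (1 / 2 : ℝ) ^ (j + 1) ≤ conc v P
  let lev' : ℕ → Finset (Fin m) → Finset (Fin m → ZMod p) := fun j U =>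
    (lev j U).filter fun v => ∃ P, conc v P ≤ (1 / 2) ^ j ∧ P.card = s
  let lv : Finset ℕ := (Finset.range m).filter fun j => β ≤ (1 / 2) ^ j
  let us : Finset (Finset (Fin m)) := Jᶜ.powerset.filter fun U => s ≤ U.card
  have hsub : badMatrices p J β w ⊆ Finset.univ.biUnion fun t : ZMod p =>
      ((sp.filter fun v => v ≠ 0).biUnion (ev t)) ∪
        lv.biUnion fun j => us.biUnion fun U => (lev' j U).biUnion (ev t) := by
    intro h hh
    obtain ⟨-, v, hv0, ⟨t, hvt⟩, hconc⟩ := Finset.mem_filter.1 hh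
    refine Finset.mem_biUnion.2 ⟨t, Finset.mem_univ _, ?_⟩
    have hev : h ∈ ev t v := Finset.mem_filter.2 ⟨Finset.mem_univ _, hvt⟩
    by_cases hsp : v ∈ sp
    · exact Finset.mem_union_left _ (Finset.mem_biUnion.2 ⟨v, Finset.mem_filter.2 ⟨hsp, hv0⟩, hev⟩)
    · refine Finset.mem_union_right _ ?_
      let U := Jᶜ.filter fun i => v i ≠ 0
      have hUJ : U ⊆ Jᶜ := Finset.filter_subset _ _
      have hUs : s ≤ U.card := by
        by_contra! hlt
        apply hsp
        refine Finset.mem_filter.2 ⟨Finset.mem_univ _, ?_⟩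
        have : (Finset.univ.filter fun i => v i ≠ 0) ⊆ J ∪ U := by
          intro i hi
          by_cases hiJ : i ∈ J
          · exact Finset.mem_union_left _ hiJ
          · exact Finset.mem_union_right _
              (Finset.mem_filter.2 ⟨Finset.mem_compl.2 hiJ, (Finset.mem_filter.1 hi).2⟩)
        have h1 := (Finset.card_le_card this).trans (Finset.card_union_le _ _)
        omega
      obtain ⟨j, hj, hjβ, hP1, hP2⟩ := exists_level hβ hβm hconc hUJ hUs
      refine Finset.mem_biUnion.2 ⟨j, Finset.mem_filter.2 ⟨hj, hjβ⟩, Finset.mem_biUnion.2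
        ⟨U, Finset.mem_filter.2 ⟨Finset.mem_powerset.2 hUJ, hUs⟩, Finset.mem_biUnion.2
        ⟨v, Finset.mem_filter.2 ⟨Finset.mem_filter.2 ⟨Finset.mem_univ _, ?_, hP2⟩, hP1⟩, hev⟩⟩⟩
      intro i hi
      simp only [U, Finset.mem_filter, hi, true_and]
  set N : ℝ := 2 ^ (m * m) with hN
  have hN0 : 0 < N := by positivity
  have hsparse : ∀ t : ZMod p, ((((sp.filter fun v => v ≠ 0).biUnion (ev t)).card : ℕ) : ℝ) ≤
      p ^ (6 * s) * (2 / 2 ^ m) * N := by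
    intro t
    refine (Nat.cast_le.2 Finset.card_biUnion_le).trans ?_
    rw [Nat.cast_sum]
    have h1 : ∀ v ∈ sp.filter fun v => v ≠ 0, ((ev t v).card : ℝ) ≤ (2 / 2 ^ m) * N := by
      intro v hv
      refine (card_signMatrix_mulVec_le_half hp2 (Finset.mem_filter.1 hv).2 _).trans_eq ?_
      obtain ⟨m', rfl⟩ : ∃ m', m = m' + 1 := ⟨m - 1, by omega⟩
      rw [Nat.add_sub_cancel, one_div, inv_pow, pow_succ (2 : ℝ) m', hN]
      field_simp
    refine (Finset.sum_le_sum h1).trans ?_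
    rw [Finset.sum_const, nsmul_eq_mul, mul_assoc]
    have h2 : (((sp.filter fun v => v ≠ 0).card : ℕ) : ℝ) ≤ p ^ (6 * s) := by
      have h3 : sp.card ≤ m ^ (3 * s) * p ^ (3 * s) := card_sparse_le hsm
      have h4 : (sp.filter fun v => v ≠ 0).card ≤ p ^ (6 * s) := by
        refine (Finset.card_filter_le _ _).trans (h3.trans ?_)
        calc m ^ (3 * s) * p ^ (3 * s) ≤ p ^ (3 * s) * p ^ (3 * s) := by gcongr
          _ = p ^ (6 * s) := by rw [← pow_add]; congr 1; ring
      exact_mod_cast h4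
    gcongr
  have hdense : ∀ t : ZMod p, (((lv.biUnion fun j => us.biUnion fun U =>
      (lev' j U).biUnion (ev t)).card : ℕ) : ℝ) ≤ p ^ (6 * s) * (1 / 2 ^ m) * N := by
    intro t
    have hev : ∀ j ∈ lv, ∀ U ∈ us, ((((lev' j U).biUnion (ev t)).card : ℕ) : ℝ) ≤
        p ^ (4 * s) * (1 / 8) ^ m * N := by
      intro j hj U hU
      have hjβ := (Finset.mem_filter.1 hj).2
      obtain ⟨hU1, hU2⟩ := Finset.mem_filter.1 hU
      rw [Finset.mem_powerset] at hU1
      refine (Nat.cast_le.2 Finset.card_biUnion_le).trans ?_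
      rw [Nat.cast_sum]
      have h1 : ∀ v ∈ lev' j U, ((ev t v).card : ℝ) ≤ ((1 / 2) ^ j) ^ (m - s) * N := by
        intro v hv
        obtain ⟨-, P, hP, hPs⟩ := Finset.mem_filter.1 hv
        refine (card_signMatrix_mulVec_le_conc hp2 P v _).trans ?_
        rw [hPs]
        have := conc_nonneg v P
        gcongr
      refine (Finset.sum_le_sum h1).trans ?_
      rw [Finset.sum_const, nsmul_eq_mul]
      set r : ℝ := (1 / 2) ^ j with hr
      have hr0 : 0 < r := by positivity
      have hr1 : r ≤ 1 := pow_le_one₀ (by norm_num) (by norm_num)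
      have h2 := card_level_le (p := p) (U := U) (ρ := (1 / 2) ^ (j + 1)) hl hL hs hJ hβ ht0 hβp
        hexp hkt htriv (by rw [pow_succ]; linarith) hU1 hU2
      set κ : ℝ := (2 * m) ^ L * 2 ^ (L + 1) * (32 * l) / (2 ^ k * (s : ℝ) ^ L) with hκ
      have hκ0 : 0 ≤ κ := by positivity
      have h3 : ((lev' j U).card : ℝ) ≤ p ^ (3 * s) * ((1 / 8) / r) ^ m := by
        refine (Nat.cast_le.2 (Finset.card_filter_le _ _)).trans (h2.trans ?_)
        gcongr
        rw [pow_succ (1 / 2 : ℝ) j, ← hr, ← mul_div_assoc, div_le_div_iff₀ (by positivity) hr0]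
        nlinarith
      have h4 : (1 / r) ^ s ≤ (p : ℝ) ^ s := by
        gcongr
        rw [div_le_iff₀ hr0]
        nlinarith
      calc ((lev' j U).card : ℝ) * (r ^ (m - s) * N)
          ≤ (p ^ (3 * s) * ((1 / 8) / r) ^ m) * (r ^ (m - s) * N) := by gcongr
        _ = p ^ (3 * s) * (1 / 8) ^ m * (1 / r) ^ s * N := by
            obtain ⟨d, hd⟩ : ∃ d, m = d + s := ⟨m - s, by omega⟩
            have : m - s = d := by omega
            rw [this, div_pow (1 / 8) r, hd, pow_add r d s, div_pow 1 r, one_pow]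
            field_simp
        _ ≤ p ^ (3 * s) * (1 / 8) ^ m * p ^ s * N := by gcongr
        _ = _ := by ring
    have hus : (us.card : ℝ) ≤ 2 ^ m := by
      have : us.card ≤ 2 ^ m := by
        refine (Finset.card_filter_le _ _).trans ?_
        rw [Finset.card_powerset]
        exact Nat.pow_le_pow_right (by norm_num)
          ((Finset.card_le_univ _).trans_eq (Fintype.card_fin m))
      exact_mod_cast this
    have hlv : (lv.card : ℝ) ≤ 2 ^ m := by
      have : lv.card ≤ 2 ^ m := (Finset.card_filter_le _ _).trans
        (by rw [Finset.card_range]; exact Nat.lt_two_pow_self.le)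
      exact_mod_cast this
    calc (((lv.biUnion fun j => us.biUnion fun U => (lev' j U).biUnion (ev t)).card : ℕ) : ℝ)
        ≤ ∑ j ∈ lv, ∑ U ∈ us, ((((lev' j U).biUnion (ev t)).card : ℕ) : ℝ) := by
          refine (Nat.cast_le.2 Finset.card_biUnion_le).trans ?_
          rw [Nat.cast_sum]
          refine Finset.sum_le_sum fun j _ => (Nat.cast_le.2 Finset.card_biUnion_le).trans ?_
          rw [Nat.cast_sum]
      _ ≤ ∑ j ∈ lv, ∑ U ∈ us, p ^ (4 * s) * (1 / 8) ^ m * N :=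
          Finset.sum_le_sum fun j hj => Finset.sum_le_sum fun U hU => hev j hj U hU
      _ = lv.card * (us.card * (p ^ (4 * s) * (1 / 8) ^ m * N)) := by
          rw [Finset.sum_const, Finset.sum_const, nsmul_eq_mul, nsmul_eq_mul]
      _ ≤ 2 ^ m * (2 ^ m * (p ^ (6 * s) * (1 / 8) ^ m * N)) := by
          gcongr
          · norm_num
      _ = p ^ (6 * s) * (1 / 2 ^ m) * N := by
          rw [div_pow, one_pow, show (8 : ℝ) = 2 * 2 * 2 by norm_num, mul_pow, mul_pow]
          field_simp
  calc ((badMatrices p J β w).card : ℝ)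
      ≤ ∑ t : ZMod p, (p ^ (6 * s) * (2 / 2 ^ m) * N + p ^ (6 * s) * (1 / 2 ^ m) * N) := by
        refine (Nat.cast_le.2 ((Finset.card_le_card hsub).trans Finset.card_biUnion_le)).trans ?_
        rw [Nat.cast_sum]
        refine Finset.sum_le_sum fun t _ => ?_
        refine (Nat.cast_le.2 (Finset.card_union_le _ _)).trans ?_
        rw [Nat.cast_add]
        exact add_le_add (hsparse t) (hdense t)
    _ = _ := by
        rw [Finset.sum_const, Finset.card_univ, ZMod.card, nsmul_eq_mul, pow_succ]
        ring

end Structured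

section Decoupling

variable {m : ℕ}

/-- The vector equal to `z` on `J` and to `y` off `J`. -/
def mixOn (J : Finset (Fin m)) (y z : Fin m → Bool) : Fin m → Bool :=
  fun i => if i ∈ J then z i else y i

/-- The quadruples contributing to the decoupled form of `E`. -/
def quadSet (J : Finset (Fin m)) (E : Finset (Fin m → Bool)) (z z' : Fin m → Bool) :
    Finset ((Fin m → Bool) × (Fin m → Bool)) :=
  Finset.univ.filter fun y => mixOn J y.1 z ∈ E ∧ mixOn J y.1 z' ∈ E ∧
    mixOn J y.2 z ∈ E ∧ mixOn J y.2 z' ∈ E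

lemma two_pow_mul_card_eq (J : Finset (Fin m)) (E : Finset (Fin m → Bool)) :
    2 ^ m * (E.card : ℝ) = ∑ y, ∑ z, if mixOn J y z ∈ E then (1 : ℝ) else 0 := by
  let σ : (Fin m → Bool) × (Fin m → Bool) → (Fin m → Bool) × (Fin m → Bool) := fun x =>
    (mixOn J x.1 x.2, mixOn J x.2 x.1)
  have hσ : Function.Involutive σ := by
    rintro ⟨y, z⟩
    refine Prod.ext ?_ ?_ <;> funext i <;> by_cases hi : i ∈ J <;> simp [σ, mixOn, hi]
  have e1 : (E ×ˢ (Finset.univ : Finset (Fin m → Bool))).card =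
      (Finset.univ.filter fun x : (Fin m → Bool) × (Fin m → Bool) => mixOn J x.1 x.2 ∈ E).card := by
    refine (Finset.card_equiv hσ.toPerm fun x => ?_).symm
    simp [σ]
  have e2 : ∑ y, ∑ z, (if mixOn J y z ∈ E then (1 : ℝ) else 0) =
      (Finset.univ.filter fun x : (Fin m → Bool) × (Fin m → Bool) => mixOn J x.1 x.2 ∈ E).card := by
    rw [← Finset.univ_product_univ, Finset.card_filter, Finset.sum_product]
    push_cast
    rfl
  rw [e2, ← e1, Finset.card_product]
  simp [mul_comm]

lemma card_pow_four_le (J : Finset (Fin m)) (E : Finset (Fin m → Bool)) :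
    (E.card : ℝ) ^ 4 ≤ ∑ z, ∑ z', ((quadSet J E z z').card : ℝ) := by
  let F : (Fin m → Bool) → (Fin m → Bool) → ℝ := fun y z => if mixOn J y z ∈ E then 1 else 0
  set N : ℝ := 2 ^ m with hN
  have hN0 : 0 < N := by positivity
  have hcard : ((Finset.univ : Finset (Fin m → Bool)).card : ℝ) = N := by simp [hN]
  have hcard2 : ((Finset.univ : Finset ((Fin m → Bool) × (Fin m → Bool))).card : ℝ) = N ^ 2 := by
    rw [← Finset.univ_product_univ, Finset.card_product, Nat.cast_mul, hcard, sq]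
  have h1 : N * (E.card : ℝ) = ∑ y, ∑ z, F y z := two_pow_mul_card_eq J E
  have h2 : (∑ y, ∑ z, F y z) ^ 2 ≤ N * ∑ x : (Fin m → Bool) × (Fin m → Bool),
      ∑ y, F y x.1 * F y x.2 := by
    have e : ∑ x : (Fin m → Bool) × (Fin m → Bool), ∑ y, F y x.1 * F y x.2 =
        ∑ y, (∑ z, F y z) ^ 2 := by
      rw [Finset.sum_comm]
      refine Finset.sum_congr rfl fun y _ => ?_
      rw [sq, Finset.sum_mul_sum, ← Finset.univ_product_univ, Finset.sum_product]
    rw [e, ← hcard]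
    exact sq_sum_le_card_mul_sum_sq
  have h3 : (∑ x : (Fin m → Bool) × (Fin m → Bool), ∑ y, F y x.1 * F y x.2) ^ 2 ≤
      N ^ 2 * ∑ x : (Fin m → Bool) × (Fin m → Bool), (∑ y, F y x.1 * F y x.2) ^ 2 := by
    rw [← hcard2]
    exact sq_sum_le_card_mul_sum_sq
  have h4 : ∀ x : (Fin m → Bool) × (Fin m → Bool),
      (∑ y, F y x.1 * F y x.2) ^ 2 = ((quadSet J E x.1 x.2).card : ℝ) := by
    intro x
    unfold quadSet
    rw [sq, Finset.sum_mul_sum, ← Finset.univ_product_univ, Finset.card_filter,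
      Finset.sum_product]
    push_cast
    refine Finset.sum_congr rfl fun y _ => Finset.sum_congr rfl fun y' _ => ?_
    by_cases a1 : mixOn J y x.1 ∈ E <;> by_cases a2 : mixOn J y x.2 ∈ E <;>
      by_cases a3 : mixOn J y' x.1 ∈ E <;> by_cases a4 : mixOn J y' x.2 ∈ E <;>
      simp [F, a1, a2, a3, a4]
  simp only [h4] at h3
  rw [Fintype.sum_prod_type (fun x => ((quadSet J E x.1 x.2).card : ℝ))] at h3
  have h5 : 0 ≤ ∑ x : (Fin m → Bool) × (Fin m → Bool), ∑ y, F y x.1 * F y x.2 :=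
    Finset.sum_nonneg fun x _ => Finset.sum_nonneg fun y _ => by
      have : ∀ y z, 0 ≤ F y z := fun y z => by simp only [F]; split_ifs <;> norm_num
      exact mul_nonneg (this _ _) (this _ _)
  have h6 : N ^ 4 * (E.card : ℝ) ^ 4 ≤ N ^ 4 * ∑ z, ∑ z', ((quadSet J E z z').card : ℝ) := by
    calc N ^ 4 * (E.card : ℝ) ^ 4 = ((N * E.card) ^ 2) ^ 2 := by ring
      _ = ((∑ y, ∑ z, F y z) ^ 2) ^ 2 := by rw [h1]
      _ ≤ (N * ∑ x : (Fin m → Bool) × (Fin m → Bool), ∑ y, F y x.1 * F y x.2) ^ 2 := by gcongr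
      _ = N ^ 2 * (∑ x : (Fin m → Bool) × (Fin m → Bool), ∑ y, F y x.1 * F y x.2) ^ 2 := by ring
      _ ≤ N ^ 2 * (N ^ 2 * ∑ z, ∑ z', ((quadSet J E z z').card : ℝ)) := by
          gcongr
      _ = _ := by ring
  exact le_of_mul_le_mul_left h6 (by positivity)

/-- Sign vector of a bit vector over a ring. -/
def signVec (R : Type*) [Ring R] (x : Fin m → Bool) : Fin m → R := fun i => ringSign R (x i)

lemma exists_eq_mul_not_dvd {p : ℕ} (hp : p.Prime) (V : Fin m → ℤ) {T : ℤ} (hT : T ≠ 0) :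
    ∃ (d : ℤ) (V₁ : Fin m → ℤ) (T₁ : ℤ), d ≠ 0 ∧ V = d • V₁ ∧ T = d * T₁ ∧
      ¬((p : ℤ) ∣ T₁ ∧ ∀ i, (p : ℤ) ∣ V₁ i) := by
  induction hn : T.natAbs using Nat.strong_induction_on generalizing V T with
  | _ n ih =>
  by_cases h : (p : ℤ) ∣ T ∧ ∀ i, (p : ℤ) ∣ V i
  · obtain ⟨⟨T', rfl⟩, hV⟩ := h
    choose V' hV' using hV
    have hT' : T' ≠ 0 := right_ne_zero_of_mul hT
    have hlt : T'.natAbs < n := by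
      rw [← hn, Int.natAbs_mul, Int.natAbs_natCast]
      exact lt_mul_of_one_lt_left (Int.natAbs_pos.2 hT') hp.one_lt
    obtain ⟨d, V₁, T₁, hd, h1, h2, h3⟩ := ih _ hlt V' hT' rfl
    refine ⟨p * d, V₁, T₁, mul_ne_zero (by exact_mod_cast hp.ne_zero) hd, ?_, ?_, h3⟩
    · funext i
      rw [hV' i, h1]
      simp [mul_assoc]
    · rw [h2, mul_assoc]
  · exact ⟨1, V, T, one_ne_zero, by simp, by simp, h⟩

lemma signMatrix_symm (R : Type*) [Ring R] (h : Fin m → Fin m → Bool) :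
    (signMatrix R h).transpose = signMatrix R h := by
  ext i j
  simp only [Matrix.transpose_apply, signMatrix, Matrix.of_apply]
  rcases lt_trichotomy i j with hij | rfl | hij
  · simp [hij.le, hij.not_ge]
  · rfl
  · simp [hij.le, hij.not_ge]

/-- The bit vectors `x` for which the bordered matrix with corner `a` is degenerate. -/
def bordered (a : ℤ) (h : Fin m → Fin m → Bool) : Finset (Fin m → Bool) :=
  Finset.univ.filter fun x => (signMatrix ℤ h).det ≠ 0 ∧
    signVec ℤ x ⬝ᵥ (signMatrix ℤ h).adjugate.mulVec (signVec ℤ x) = a * (signMatrix ℤ h).det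

lemma card_quadSet_le {p : ℕ} [Fact p.Prime] (hp2 : p ≠ 2) (J : Finset (Fin m)) {β : ℝ}
    (hβ : 0 ≤ β) (a : ℤ) (h : Fin m → Fin m → Bool) {z z' : Fin m → Bool} (hz : ∃ i ∈ J, z i ≠ z' i)
    (hbad : h ∉ badMatrices p J β fun i =>
      if i ∈ J then signVec (ZMod p) z i - signVec (ZMod p) z' i else 0) :
    ((quadSet J (bordered a h) z z').card : ℝ) ≤ β * (2 ^ m) ^ 2 := by
  have hpp : p.Prime := Fact.out
  set A := signMatrix ℤ h with hA
  set T := A.det with hT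
  let Z : (Fin m → Bool) → Fin m → ℤ := fun z i => if i ∈ J then signVec ℤ z i else 0
  let Y : (Fin m → Bool) → Fin m → ℤ := fun y i => if i ∈ J then 0 else signVec ℤ y i
  have hmix : ∀ y z, signVec ℤ (mixOn J y z) = Y y + Z z := fun y z => by
    funext i
    by_cases hi : i ∈ J <;> simp [signVec, mixOn, Y, Z, hi]
  set V : Fin m → ℤ := A.adjugate.mulVec (Z z - Z z') with hV
  have hkey : ∀ x ∈ quadSet J (bordered a h) z z', T ≠ 0 ∧ Y x.1 ⬝ᵥ V = Y x.2 ⬝ᵥ V := by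
    intro x hx
    obtain ⟨-, h1, h2, h3, h4⟩ := Finset.mem_filter.1 hx
    obtain ⟨-, hT0, h1⟩ := Finset.mem_filter.1 h1
    obtain ⟨-, -, h2⟩ := Finset.mem_filter.1 h2
    obtain ⟨-, -, h3⟩ := Finset.mem_filter.1 h3
    obtain ⟨-, -, h4⟩ := Finset.mem_filter.1 h4
    refine ⟨hT0, ?_⟩
    have hsymm : ∀ u w : Fin m → ℤ, u ⬝ᵥ A.adjugate.mulVec w = w ⬝ᵥ A.adjugate.mulVec u := by
      intro u w
      rw [Matrix.dotProduct_mulVec, ← Matrix.mulVec_transpose, Matrix.adjugate_transpose,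
        signMatrix_symm, dotProduct_comm]
    simp only [hmix, Matrix.mulVec_add, add_dotProduct, dotProduct_add] at h1 h2 h3 h4
    rw [hsymm (Z z) (Y x.1)] at h1
    rw [hsymm (Z z') (Y x.1)] at h2
    rw [hsymm (Z z) (Y x.2)] at h3
    rw [hsymm (Z z') (Y x.2)] at h4
    rw [hV, Matrix.mulVec_sub, dotProduct_sub, dotProduct_sub]
    linarith
  rcases (quadSet J (bordered a h) z z').eq_empty_or_nonempty with he | ⟨x₀, hx₀⟩
  · rw [he, Finset.card_empty, Nat.cast_zero]
    positivity
  have hT0 := (hkey x₀ hx₀).1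
  obtain ⟨d, V₁, T₁, hd, hV₁, hT₁, hprim⟩ := exists_eq_mul_not_dvd hpp V hT0
  have hAV : A.mulVec V₁ = T₁ • (Z z - Z z') := by
    have e1 : A.mulVec V = T • (Z z - Z z') := by
      rw [hV, Matrix.mulVec_mulVec, Matrix.mul_adjugate, Matrix.smul_mulVec, Matrix.one_mulVec]
    rw [hV₁, Matrix.mulVec_smul, hT₁, mul_smul] at e1
    exact smul_right_injective _ hd e1
  let v : Fin m → ZMod p := fun i => (V₁ i : ZMod p)
  have hcs : ∀ b, ((ringSign ℤ b : ℤ) : ZMod p) = ringSign (ZMod p) b := by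
    intro b; cases b <;> simp [ringSign]
  have hAv : (signMatrix (ZMod p) h).mulVec v = (T₁ : ZMod p) • fun i =>
      if i ∈ J then signVec (ZMod p) z i - signVec (ZMod p) z' i else 0 := by
    funext i
    have e := congrArg (Int.cast : ℤ → ZMod p) (congrFun hAV i)
    simp only [Matrix.mulVec, dotProduct, Int.cast_sum, Int.cast_mul, Pi.smul_apply, Pi.sub_apply,
      smul_eq_mul, Int.cast_sub] at e ⊢
    rw [show (∑ j, signMatrix (ZMod p) h i j * v j) = ∑ j, ((A i j : ℤ) : ZMod p) * (V₁ j : ZMod p)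
      from Finset.sum_congr rfl fun j _ => by
        simp only [hA, signMatrix, Matrix.of_apply, v]
        split_ifs <;> rw [hcs], e]
    congr 1
    by_cases hi : i ∈ J <;> simp [Z, hi, signVec, hcs]
  have hv0 : v ≠ 0 := by
    intro hv0
    have hVp : ∀ i, (p : ℤ) ∣ V₁ i := fun i =>
      (ZMod.intCast_zmod_eq_zero_iff_dvd _ _).1 (congrFun hv0 i)
    refine hprim ⟨?_, hVp⟩
    obtain ⟨i, hiJ, hi⟩ := hz
    rw [← ZMod.intCast_zmod_eq_zero_iff_dvd]
    have e := congrFun hAv i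
    rw [hv0, Matrix.mulVec_zero] at e
    simp only [Pi.zero_apply, Pi.smul_apply, if_pos hiJ, smul_eq_mul] at e
    rcases mul_eq_zero.1 e.symm with h0 | h0
    · exact h0
    · exfalso
      have h2 : (2 : ZMod p) ≠ 0 := by
        intro h0
        have : (p : ℕ) ∣ 2 := (ZMod.natCast_eq_zero_iff 2 p).1 (by exact_mod_cast h0)
        exact hp2 ((Nat.prime_dvd_prime_iff_eq hpp Nat.prime_two).1 this)
      cases hzi : z i <;> cases hzi' : z' i <;> simp only [hzi, hzi', ne_eq, not_true_eq_false] at hi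
      · simp only [signVec, ringSign, hzi, hzi'] at h0
        apply h2
        simp only [Bool.false_eq_true, if_false, if_true] at h0
        linear_combination -h0
      · simp only [signVec, ringSign, hzi, hzi'] at h0
        apply h2
        simp only [Bool.false_eq_true, if_false, if_true] at h0
        linear_combination h0
  have hconc : conc v Jᶜ < β := by
    by_contra! hcon
    exact hbad (Finset.mem_filter.2 ⟨Finset.mem_univ _, v, hv0, ⟨_, hAv⟩, hcon⟩)
  have hsub : quadSet J (bordered a h) z z' ⊆ Finset.univ.biUnion fun y' : Fin m → Bool =>
      (Finset.univ.filter fun ξ : Fin m → Bool => ∑ j ∈ Jᶜ, ringSign (ZMod p) (ξ j) * v j =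
        ∑ j ∈ Jᶜ, ringSign (ZMod p) (y' j) * v j) ×ˢ {y'} := by
    rintro ⟨y, y'⟩ hx
    refine Finset.mem_biUnion.2 ⟨y', Finset.mem_univ _, Finset.mem_product.2
      ⟨Finset.mem_filter.2 ⟨Finset.mem_univ _, ?_⟩, Finset.mem_singleton_self _⟩⟩
    have e := (hkey _ hx).2
    rw [hV₁, dotProduct_smul, dotProduct_smul] at e
    have e' := congrArg (Int.cast : ℤ → ZMod p) (smul_right_injective _ hd e)
    have hY : ∀ y, ((Y y ⬝ᵥ V₁ : ℤ) : ZMod p) = ∑ j ∈ Jᶜ, ringSign (ZMod p) (y j) * v j := by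
      intro y
      rw [dotProduct, Int.cast_sum, ← Finset.sum_compl_add_sum J]
      rw [Finset.sum_eq_zero (s := J) fun j hj => by simp [Y, hj], add_zero]
      refine Finset.sum_congr rfl fun j hj => ?_
      simp [Y, Finset.mem_compl.1 hj, signVec, hcs, v]
    rw [← hY, ← hY]
    exact e'
  calc ((quadSet J (bordered a h) z z').card : ℝ)
      ≤ ∑ y' : Fin m → Bool, conc v Jᶜ * 2 ^ m := by
        refine (Nat.cast_le.2 ((Finset.card_le_card hsub).trans Finset.card_biUnion_le)).trans ?_
        rw [Nat.cast_sum]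
        refine Finset.sum_le_sum fun y' _ => ?_
        rw [Finset.card_product, Finset.card_singleton, mul_one]
        exact card_signed_sum_le hp2 v Jᶜ _
    _ = conc v Jᶜ * (2 ^ m) ^ 2 := by
        rw [Finset.sum_const, Finset.card_univ, nsmul_eq_mul]
        simp
        ring
    _ ≤ _ := by gcongr

end Decoupling

section Assembly

variable {m : ℕ}

lemma card_agree_eq (J : Finset (Fin m)) (z : Fin m → Bool) :
    ((Finset.univ.filter fun z' : Fin m → Bool => ∀ i ∈ J, z i = z' i).card : ℝ) =
      2 ^ m * (1 / 2) ^ J.card := by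
  have h : (Finset.univ.filter fun z' : Fin m → Bool => ∀ i ∈ J, z i = z' i) =
      Fintype.piFinset fun i => if i ∈ Jᶜ then Finset.univ else {z i} := by
    ext z'
    simp only [Finset.mem_filter, Finset.mem_univ, true_and, Fintype.mem_piFinset,
      Finset.mem_compl]
    refine forall_congr' fun i => ?_
    by_cases hi : i ∈ J
    · simp [hi, eq_comm (a := z i)]
    · simp [hi]
  have hc := Finset.card_add_card_compl J
  rw [Fintype.card_fin] at hc
  rw [h, Fintype.card_piFinset]
  simp only [apply_ite Finset.card, Finset.card_univ, Fintype.card_bool, Finset.card_singleton]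
  rw [Finset.prod_ite_mem, Finset.univ_inter, Finset.prod_const]
  have h2 : (2 : ℝ) ^ m = 2 ^ J.card * 2 ^ Jᶜ.card := by rw [← pow_add, hc]
  rw [h2, one_div, inv_pow]
  push_cast
  field_simp

lemma sum_card_bordered_pow_le {p : ℕ} [Fact p.Prime] (hp2 : p ≠ 2) (J : Finset (Fin m)) {β b : ℝ}
    (hβ : 0 ≤ β)
    (hb : ∀ w : Fin m → ZMod p, ((badMatrices p J β w).card : ℝ) ≤ b * 2 ^ (m * m)) (a : ℤ) :
    ∑ h : Fin m → Fin m → Bool, ((bordered a h).card : ℝ) ^ 4 ≤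
      (2 ^ m) ^ 4 * 2 ^ (m * m) * ((1 / 2) ^ J.card + b + β) := by
  set N : ℝ := 2 ^ m with hN
  have hN0 : 0 < N := by positivity
  have hcard : (Fintype.card (Fin m → Bool) : ℝ) = N := by simp [hN]
  have hcardB : (Fintype.card (Fin m → Fin m → Bool) : ℝ) = 2 ^ (m * m) := by
    simp [← pow_mul]
  let w : (Fin m → Bool) → (Fin m → Bool) → Fin m → ZMod p := fun z z' i =>
    if i ∈ J then signVec (ZMod p) z i - signVec (ZMod p) z' i else 0
  have hpt : ∀ (h : Fin m → Fin m → Bool) z z', ((quadSet J (bordered a h) z z').card : ℝ) ≤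
      (if ∀ i ∈ J, z i = z' i then N ^ 2 else 0) +
        (if h ∈ badMatrices p J β (w z z') then N ^ 2 else 0) + β * N ^ 2 := by
    intro h z z'
    have htriv : ((quadSet J (bordered a h) z z').card : ℝ) ≤ N ^ 2 := by
      refine (Nat.cast_le.2 (Finset.card_le_univ _)).trans_eq ?_
      rw [Fintype.card_prod, Nat.cast_mul, hcard, sq]
    have hβN : 0 ≤ β * N ^ 2 := by positivity
    by_cases hag : ∀ i ∈ J, z i = z' i
    · rw [if_pos hag]
      have : (0 : ℝ) ≤ if h ∈ badMatrices p J β (w z z') then N ^ 2 else 0 := by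
        split_ifs <;> positivity
      linarith
    · rw [if_neg hag]
      by_cases hbad : h ∈ badMatrices p J β (w z z')
      · rw [if_pos hbad]
        linarith
      · rw [if_neg hbad]
        push Not at hag
        have := card_quadSet_le hp2 J hβ a h hag hbad
        linarith
  calc ∑ h : Fin m → Fin m → Bool, ((bordered a h).card : ℝ) ^ 4
      ≤ ∑ h : Fin m → Fin m → Bool, ∑ z, ∑ z',
        ((if ∀ i ∈ J, z i = z' i then N ^ 2 else 0) +
          (if h ∈ badMatrices p J β (w z z') then N ^ 2 else 0) + β * N ^ 2) :=
        Finset.sum_le_sum fun h _ => (card_pow_four_le J _).trans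
          (Finset.sum_le_sum fun z _ => Finset.sum_le_sum fun z' _ => hpt h z z')
    _ = ∑ z, ∑ z', ∑ h : Fin m → Fin m → Bool,
        ((if ∀ i ∈ J, z i = z' i then N ^ 2 else 0) +
          (if h ∈ badMatrices p J β (w z z') then N ^ 2 else 0) + β * N ^ 2) := by
        rw [Finset.sum_comm]
        refine Finset.sum_congr rfl fun z _ => ?_
        rw [Finset.sum_comm]
    _ ≤ ∑ z : Fin m → Bool, ∑ z' : Fin m → Bool,
        (2 ^ (m * m) * (if ∀ i ∈ J, z i = z' i then N ^ 2 else 0) + b * 2 ^ (m * m) * N ^ 2 +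
          2 ^ (m * m) * (β * N ^ 2)) := by
        refine Finset.sum_le_sum fun z _ => Finset.sum_le_sum fun z' _ => ?_
        rw [Finset.sum_add_distrib, Finset.sum_add_distrib, Finset.sum_const, Finset.sum_const,
          Finset.card_univ, nsmul_eq_mul, nsmul_eq_mul, hcardB, Finset.sum_ite_mem,
          Finset.univ_inter, Finset.sum_const, nsmul_eq_mul]
        gcongr
        exact hb _
    _ = _ := by
        have hag : ∀ z : Fin m → Bool, ∑ z' : Fin m → Bool,
            (if ∀ i ∈ J, z i = z' i then N ^ 2 else 0) = N * (1 / 2) ^ J.card * N ^ 2 := by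
          intro z
          rw [← Finset.sum_filter, Finset.sum_const, nsmul_eq_mul, card_agree_eq]
        simp only [Finset.sum_add_distrib, ← Finset.mul_sum, hag, Finset.sum_const,
          Finset.card_univ, nsmul_eq_mul, hcard]
        ring

lemma mem_bordered_of_det_eq_zero {g : Fin (m + 1) → Fin (m + 1) → Bool}
    (hg : (signMatrix ℤ g).det = 0)
    (hA : (signMatrix ℤ fun i j : Fin m => g i.succ j.succ).det ≠ 0) :
    (fun i : Fin m => g 0 i.succ) ∈
      bordered (ringSign ℤ (g 0 0)) fun i j : Fin m => g i.succ j.succ := by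
  set A := signMatrix ℤ fun i j : Fin m => g i.succ j.succ with hAdef
  set x := signVec ℤ fun i : Fin m => g 0 i.succ with hx
  refine Finset.mem_filter.2 ⟨Finset.mem_univ _, hA, ?_⟩
  change x ⬝ᵥ A.adjugate.mulVec x = ringSign ℤ (g 0 0) * A.det
  obtain ⟨y, hy0, hy⟩ := Matrix.exists_mulVec_eq_zero_iff.2 hg
  let y' : Fin m → ℤ := fun i => y i.succ
  have hrow0 : ringSign ℤ (g 0 0) * y 0 + x ⬝ᵥ y' = 0 := by
    have e := congrFun hy 0
    rw [Matrix.mulVec, dotProduct, Fin.sum_univ_succ] at e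
    simpa [signMatrix, dotProduct, x, y', signVec] using e
  have hrow : y 0 • x + A.mulVec y' = 0 := by
    funext i
    have e := congrFun hy i.succ
    rw [Matrix.mulVec, dotProduct, Fin.sum_univ_succ] at e
    simp only [signMatrix, Matrix.of_apply, Fin.le_zero_iff, Fin.succ_ne_zero, if_false,
      Fin.succ_le_succ_iff, Pi.zero_apply] at e
    simp only [Pi.add_apply, Pi.smul_apply, smul_eq_mul, Matrix.mulVec, dotProduct, hAdef,
      signMatrix, Matrix.of_apply, Pi.zero_apply, hx, signVec, y']
    rw [mul_comm (y 0)]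
    exact e
  have hadj : y 0 • A.adjugate.mulVec x + A.det • y' = 0 := by
    have e := congrArg A.adjugate.mulVec hrow
    rwa [Matrix.mulVec_add, Matrix.mulVec_smul, Matrix.mulVec_mulVec, Matrix.adjugate_mul,
      Matrix.smul_mulVec, Matrix.one_mulVec, Matrix.mulVec_zero] at e
  have hdot : y 0 * (x ⬝ᵥ A.adjugate.mulVec x) + A.det * (x ⬝ᵥ y') = 0 := by
    have e := congrArg (fun u => x ⬝ᵥ u) hadj
    rw [dotProduct_add, dotProduct_smul, dotProduct_smul] at e
    simpa using e
  have hy00 : y 0 ≠ 0 := by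
    intro h0
    rw [h0, zero_smul, zero_add] at hadj
    have hy' : y' = 0 := (smul_eq_zero.1 hadj).resolve_left hA
    apply hy0
    funext i
    refine Fin.cases h0 (fun j => ?_) i
    exact congrFun hy' j
  refine mul_left_cancel₀ hy00 ?_
  linear_combination hdot - A.det * hrow0

lemma det_symMat (n : ℕ) (g : Fin n → Fin n → Bool) :
    (symMat n g).det = ((signMatrix ℤ g).det : ℝ) := by
  have h : symMat n g = (Int.castRingHom ℝ).mapMatrix (signMatrix ℤ g) := by
    ext i j
    simp only [symMat, signMatrix, RingHom.mapMatrix_apply, Matrix.map_apply, Matrix.of_apply,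
      signv, ringSign]
    split_ifs <;> simp
  rw [h, ← RingHom.map_det]
  rfl

lemma probSym_pow_four_le {p : ℕ} [Fact p.Prime] (hp2 : p ≠ 2) (J : Finset (Fin m)) {β b : ℝ}
    (hβ : 0 ≤ β)
    (hb : ∀ w : Fin m → ZMod p, ((badMatrices p J β w).card : ℝ) ≤ b * 2 ^ (m * m))
    {Q : Matrix (Fin (m + 1)) (Fin (m + 1)) ℝ → Prop}
    (hQ : ∀ M, Q M → M.det = 0 ∧ (M.submatrix Fin.succ Fin.succ).rank = m) :
    probSym (m + 1) Q ^ 4 ≤ (1 / 2) ^ J.card + b + β := by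
  set G := Finset.univ.filter fun g : Fin (m + 1) → Fin (m + 1) → Bool => Q (symMat (m + 1) g)
    with hG
  let Ω := (Bool × (Fin m → Bool)) × (Fin m → Fin m → Bool)
  let proj : (Fin (m + 1) → Fin (m + 1) → Bool) → Ω × (Fin m → Bool) := fun g =>
    (((g 0 0, fun i => g i.succ 0), fun i j => g i.succ j.succ), fun i => g 0 i.succ)
  have hinj : Function.Injective proj := by
    intro g g' h
    have h1 : g 0 0 = g' 0 0 := congrArg (fun x => x.1.1.1) h
    have h2 : (fun i : Fin m => g i.succ 0) = fun i => g' i.succ 0 :=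
      congrArg (fun x => x.1.1.2) h
    have h3 : (fun i j : Fin m => g i.succ j.succ) = fun i j => g' i.succ j.succ :=
      congrArg (fun x => x.1.2) h
    have h4 : (fun i : Fin m => g 0 i.succ) = fun i => g' 0 i.succ := congrArg (fun x => x.2) h
    funext i j
    refine Fin.cases ?_ (fun i => ?_) i <;> refine Fin.cases ?_ (fun j => ?_) j
    · exact h1
    · exact congrFun h4 j
    · exact congrFun h2 i
    · exact congrFun (congrFun h3 i) j
  have hGcard : G.card ≤ ∑ ω : Ω, (bordered (ringSign ℤ ω.1.1) ω.2).card := by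
    have h1 : G.card ≤ (Finset.univ.sigma fun ω : Ω => bordered (ringSign ℤ ω.1.1) ω.2).card := by
      refine Finset.card_le_card_of_injOn (fun g => ⟨(proj g).1, (proj g).2⟩) ?_ ?_
      · intro g hg
        obtain ⟨hdet, hrank⟩ := hQ _ (Finset.mem_filter.1 hg).2
        refine Finset.mem_coe.2 (Finset.mem_sigma.2 ⟨Finset.mem_univ _, ?_⟩)
        refine mem_bordered_of_det_eq_zero ?_ ?_
        · rw [det_symMat] at hdet
          exact_mod_cast hdet
        · intro h0
          have hsub : (symMat (m + 1) g).submatrix Fin.succ Fin.succ =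
              symMat m fun i j => g i.succ j.succ := by
            ext i j
            simp [symMat]
          rw [hsub] at hrank
          have hdet0 : (symMat m fun i j => g i.succ j.succ).det = 0 := by
            rw [det_symMat, h0, Int.cast_zero]
          obtain ⟨y, hy0, hy⟩ := Matrix.exists_mulVec_eq_zero_iff.2 hdet0
          have hrn := LinearMap.finrank_range_add_finrank_ker
            (symMat m fun i j => g i.succ j.succ).mulVecLin
          rw [Matrix.rank] at hrank
          rw [hrank, Module.finrank_fin_fun] at hrn
          have hker : Module.finrank ℝ
              (LinearMap.ker (symMat m fun i j => g i.succ j.succ).mulVecLin) = 0 := by omega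
          rw [Submodule.finrank_eq_zero] at hker
          have hmem : y ∈ LinearMap.ker (symMat m fun i j => g i.succ j.succ).mulVecLin := hy
          rw [hker] at hmem
          exact hy0 ((Submodule.mem_bot ℝ).1 hmem)
      · intro g _ g' _ h
        apply hinj
        simp only [Sigma.mk.injEq] at h
        exact Prod.ext h.1 (eq_of_heq h.2)
    rwa [Finset.card_sigma] at h1
  set N : ℝ := 2 ^ m with hN
  set H : ℝ := 2 ^ (m * m) with hH
  have hN0 : 0 < N := by positivity
  have hH0 : 0 < H := by positivity
  have hΩ : (Fintype.card Ω : ℝ) = 2 * N * H := by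
    simp [Ω, Fintype.card_prod, hN, hH, ← pow_mul]
  have htot : (Fintype.card (Fin (m + 1) → Fin (m + 1) → Bool) : ℝ) = 2 * N * H * N := by
    simp only [Fintype.card_pi, Finset.prod_const, Fintype.card_bool, Finset.card_univ,
      Fintype.card_fin, ← pow_mul, hN, hH]
    push_cast
    ring
  have hpow : (G.card : ℝ) ^ 4 ≤ (2 * N * H) ^ 3 *
      ∑ ω : Ω, ((bordered (ringSign ℤ ω.1.1) ω.2).card : ℝ) ^ 4 := by
    have h1 : (G.card : ℝ) ≤ ∑ ω : Ω, ((bordered (ringSign ℤ ω.1.1) ω.2).card : ℝ) := by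
      exact_mod_cast hGcard
    have h2 := pow_sum_div_card_le_sum_pow (s := (Finset.univ : Finset Ω))
      (f := fun ω => ((bordered (ringSign ℤ ω.1.1) ω.2).card : ℝ)) (fun _ _ => by positivity) 3
    rw [Finset.card_univ, hΩ, div_le_iff₀ (by positivity)] at h2
    calc (G.card : ℝ) ^ 4 ≤ _ := pow_le_pow_left₀ (by positivity) h1 4
      _ ≤ _ := h2
      _ = _ := mul_comm _ _
  have hsum : ∑ ω : Ω, ((bordered (ringSign ℤ ω.1.1) ω.2).card : ℝ) ^ 4 ≤
      2 * N * (N ^ 4 * H * ((1 / 2) ^ J.card + b + β)) := by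
    rw [Fintype.sum_prod_type]
    refine (Finset.sum_le_sum fun c _ =>
      sum_card_bordered_pow_le hp2 J hβ hb (ringSign ℤ c.1)).trans_eq ?_
    have hc : (Fintype.card (Bool × (Fin m → Bool)) : ℝ) = 2 * N := by
      simp [Fintype.card_prod, hN]
    rw [Finset.sum_const, Finset.card_univ, nsmul_eq_mul, hc]
  unfold probSym
  rw [htot, div_pow, div_le_iff₀ (by positivity)]
  calc (G.card : ℝ) ^ 4 ≤ (2 * N * H) ^ 3 *
        (2 * N * (N ^ 4 * H * ((1 / 2) ^ J.card + b + β))) := hpow.trans (by gcongr)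
    _ = _ := by ring

end Assembly

section Parameters

lemma exists_pow_le_lt_succ_pow {a : ℕ} (ha : 0 < a) (m : ℕ) : ∃ r : ℕ, r ^ a ≤ m ∧ m < (r + 1) ^ a := by
  refine ⟨Nat.findGreatest (fun r => r ^ a ≤ m) m, ?_, ?_⟩
  · exact Nat.findGreatest_spec (P := fun r => r ^ a ≤ m) (Nat.zero_le m) (by simp [ha.ne'])
  · by_contra! h
    have h1 : Nat.findGreatest (fun r => r ^ a ≤ m) m + 1 ≤ m :=
      (Nat.le_self_pow ha.ne' _).trans h
    exact absurd (Nat.le_findGreatest (P := fun r => r ^ a ≤ m) h1 h) (by omega)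

lemma eventually_pow_le_two_pow (M : ℕ) : ∃ R : ℕ, ∀ r ≥ R, (2 * r) ^ M ≤ 2 ^ r := by
  have h := tendsto_pow_const_div_const_pow_of_one_lt M (r := (2 : ℝ)) (by norm_num)
  have hpos : (0 : ℝ) < 1 / 2 ^ M := by positivity
  obtain ⟨R, hR⟩ := Filter.eventually_atTop.1 (h.eventually (gt_mem_nhds hpos))
  refine ⟨R, fun r hr => ?_⟩
  have h1 := hR r hr
  rw [div_lt_div_iff₀ (by positivity) (by positivity), one_mul] at h1
  have h2 : ((2 : ℝ) * r) ^ M ≤ 2 ^ r := by rw [mul_pow, mul_comm]; exact h1.le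
  exact_mod_cast h2

lemma exists_two_pow_near {x : ℕ} (hx : 1 ≤ x) : ∃ k : ℕ, x ≤ 2 ^ k ∧ 2 ^ k ≤ 2 * x := by
  obtain ⟨n, h1, h2⟩ := exists_nat_pow_near hx (y := 2) (by norm_num)
  exact ⟨n + 1, h2.le, by rw [pow_succ]; omega⟩

/-- Admissible parameters for the counting bound, with concentration threshold `m ^ (-c)`. -/
lemma exists_parameters {c : ℕ} (hc : 0 < c) : ∃ m₀ : ℕ, ∀ m ≥ m₀, ∃ p s k l L : ℕ, ∃ t : ℝ,
    p.Prime ∧ p ≠ 2 ∧ 0 < l ∧ L + 1 = 2 * l ∧ 0 < s ∧ 0 < m ∧ 0 ≤ t ∧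
    8 * (m : ℝ) ^ c ≤ p ∧ 8 * (m : ℝ) ^ c ≤ Real.exp (t / 2) ∧ 4 ^ k * t ≤ (s : ℝ) / 16 ∧
    16 * (2 * l : ℝ) ^ (2 * l) * m ^ c ≤ (s : ℝ) ^ l ∧ 3 * s ≤ m ∧ m ≤ p ∧
    (m : ℝ) ^ c ≤ 2 ^ s ∧
    2 ^ 2 ^ (L + 3) * ((2 * m) ^ L * 2 ^ (L + 1) * (32 * l) / (2 ^ k * (s : ℝ) ^ L)) ≤ 1 / 16 ∧
    3 * (p : ℝ) ^ (6 * s + 1) * m ^ c ≤ 2 ^ m := by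
  obtain ⟨l, hl⟩ : ∃ l, l = 2 * c := ⟨_, rfl⟩
  obtain ⟨L, hL⟩ : ∃ L, L + 1 = 2 * l := ⟨2 * l - 1, by omega⟩
  obtain ⟨e, he⟩ : ∃ e, e = 2 * L + 2 := ⟨_, rfl⟩
  set K : ℕ := 16 * 2 ^ 2 ^ (L + 3) * 2 ^ L * 2 ^ (L + 1) * (32 * l) * 2 ^ ((e + 1) * L) with hK
  have hKpos : 1 ≤ K := by
    have : 0 < l := by omega
    exact Nat.one_le_iff_ne_zero.2 (by positivity)
  set B : ℕ := 6 + 4 * ((e + 1) * c) with hB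
  obtain ⟨R, hR⟩ := eventually_pow_le_two_pow (9 * ((e + 1) * c + 4))
  set R₁ : ℕ := R + 3 + 64 * K ^ 2 * B + 16 * (2 * l) ^ (2 * l) * 2 ^ ((e + 1) * c) with hR₁
  refine ⟨R₁ ^ (e + 1), fun m hm => ?_⟩
  obtain ⟨r, hr1, hr2⟩ := exists_pow_le_lt_succ_pow (Nat.succ_pos e) m
  have hrR : R₁ ≤ r := by
    have := lt_of_pow_lt_pow_left₀ _ (Nat.zero_le _) (hm.trans_lt hr2)
    omega
  have hr3 : 3 ≤ r := by omega
  have hr0 : 0 < r := by omega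
  have hm0 : 0 < m := (pow_pos hr0 _).trans_le hr1
  have hm2 : m ≤ (2 * r) ^ (e + 1) := hr2.le.trans (Nat.pow_le_pow_left (by omega) _)
  have hmc : m ^ c ≤ (2 * r) ^ ((e + 1) * c) := by
    rw [pow_mul]
    exact Nat.pow_le_pow_left hm2 c
  have hmc1 : 1 ≤ m ^ c := Nat.one_le_pow _ _ hm0
  obtain ⟨p, hp, hp1, hp2⟩ := Nat.exists_prime_lt_and_le_two_mul (8 * m ^ c) (by omega)
  obtain ⟨k, hk1, hk2⟩ := exists_two_pow_near (x := K * r ^ L)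
    (Nat.one_le_iff_ne_zero.2 (by positivity))
  have hmp : m ^ c ≤ p := by omega
  have hs0 : 0 < r ^ e := by positivity
  have hpr : p ≤ (2 * r) ^ ((e + 1) * c + 4) := by
    calc p ≤ 16 * m ^ c := by omega
      _ ≤ (2 * r) ^ 4 * (2 * r) ^ ((e + 1) * c) := by
          refine Nat.mul_le_mul ?_ hmc
          calc 16 = 2 ^ 4 := by norm_num
            _ ≤ _ := Nat.pow_le_pow_left (by omega) 4
      _ = _ := by rw [← pow_add, add_comm]
  have hpow : p ^ (9 * r ^ e) ≤ 2 ^ r ^ (e + 1) := by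
    calc p ^ (9 * r ^ e) ≤ ((2 * r) ^ ((e + 1) * c + 4)) ^ (9 * r ^ e) :=
          Nat.pow_le_pow_left hpr _
      _ = ((2 * r) ^ (9 * ((e + 1) * c + 4))) ^ r ^ e := by rw [← pow_mul, ← pow_mul]; ring_nf
      _ ≤ (2 ^ r) ^ r ^ e := Nat.pow_le_pow_left (hR r (by omega)) _
      _ = 2 ^ r ^ (e + 1) := by rw [← pow_mul]; ring_nf
  have hsc : m ^ c ≤ 2 ^ r ^ e := by
    calc m ^ c ≤ p := hmp
      _ ≤ (2 * r) ^ ((e + 1) * c + 4) := hpr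
      _ ≤ (2 * r) ^ (9 * ((e + 1) * c + 4)) := Nat.pow_le_pow_right (by omega) (by omega)
      _ ≤ 2 ^ r := hR r (by omega)
      _ ≤ _ := Nat.pow_le_pow_right (by norm_num) (Nat.le_self_pow (by omega) r)
  have hrR' : (1 : ℝ) ≤ r := by exact_mod_cast hr0
  refine ⟨p, r ^ e, k, l, L, B * r, hp, by omega, by omega, hL, hs0, hm0, by positivity,
    by exact_mod_cast hp1.le, ?_, ?_, ?_, ?_, ?_, by exact_mod_cast hsc, ?_, ?_⟩
  · have h1 : (m : ℝ) ^ c ≤ (2 * r) ^ ((e + 1) * c) := by exact_mod_cast hmc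
    have h2 : (2 * r : ℝ) ≤ Real.exp (2 * r) := by
      have := Real.add_one_le_exp (2 * r : ℝ)
      linarith
    have h3 : (8 : ℝ) ≤ Real.exp 3 := by
      have h := Real.add_one_le_exp (1 : ℝ)
      have : Real.exp 3 = Real.exp 1 ^ 3 := by rw [← Real.exp_nat_mul]; norm_num
      rw [this]
      calc (8 : ℝ) = 2 ^ 3 := by norm_num
        _ ≤ _ := pow_le_pow_left₀ (by norm_num) (by linarith) 3
    calc 8 * (m : ℝ) ^ c ≤ Real.exp 3 * Real.exp (2 * r) ^ ((e + 1) * c) := by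
          refine mul_le_mul h3 (h1.trans ?_) (by positivity) (by positivity)
          exact pow_le_pow_left₀ (by positivity) h2 _
      _ = Real.exp (3 + ((e + 1) * c : ℕ) * (2 * r)) := by
          rw [← Real.exp_nat_mul, ← Real.exp_add]
      _ ≤ _ := by
          apply Real.exp_le_exp.2
          rw [hB]
          push_cast
          nlinarith
  · have h1 : 16 * (4 ^ k * (B * r)) ≤ r ^ e := by
      have h4 : 4 ^ k = (2 ^ k) ^ 2 := by rw [← pow_mul, mul_comm, pow_mul]; norm_num
      calc 16 * (4 ^ k * (B * r)) ≤ 16 * ((2 * (K * r ^ L)) ^ 2 * (B * r)) := by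
            rw [h4]
            gcongr
        _ = (64 * K ^ 2 * B) * r ^ (2 * L + 1) := by ring
        _ ≤ r * r ^ (2 * L + 1) := Nat.mul_le_mul_right _ (by omega)
        _ = r ^ e := by rw [he]; ring
    have h2 : 16 * ((4 : ℝ) ^ k * (B * r)) ≤ (r ^ e : ℕ) := by exact_mod_cast h1
    linarith
  · have h1 : 16 * (2 * l) ^ (2 * l) * m ^ c ≤ (r ^ e) ^ l := by
      calc 16 * (2 * l) ^ (2 * l) * m ^ c
          ≤ 16 * (2 * l) ^ (2 * l) * (2 * r) ^ ((e + 1) * c) := Nat.mul_le_mul_left _ hmc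
        _ = (16 * (2 * l) ^ (2 * l) * 2 ^ ((e + 1) * c)) * r ^ ((e + 1) * c) := by
            rw [mul_pow]; ring
        _ ≤ r * r ^ ((e + 1) * c) := Nat.mul_le_mul_right _ (by omega)
        _ = r ^ ((e + 1) * c + 1) := by ring
        _ ≤ r ^ (e * l) := by
            refine Nat.pow_le_pow_right hr0 ?_
            rw [hl]
            nlinarith
        _ = _ := by rw [pow_mul]
    exact_mod_cast h1
  · calc 3 * r ^ e ≤ r * r ^ e := Nat.mul_le_mul_right _ hr3
      _ = r ^ (e + 1) := by ring
      _ ≤ m := hr1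
  · exact (Nat.le_self_pow hc.ne' m).trans hmp
  · have h1 : (K : ℝ) * r ^ L ≤ 2 ^ k := by exact_mod_cast hk1
    have h2 : (m : ℝ) ≤ 2 ^ (e + 1) * r * (r ^ e : ℕ) := by
      have : (m : ℝ) ≤ (2 * r) ^ (e + 1) := by exact_mod_cast hm2
      refine this.trans_eq ?_
      push_cast
      ring
    have hsR : (0 : ℝ) < (r ^ e : ℕ) := by exact_mod_cast hs0
    set S : ℝ := ((r ^ e : ℕ) : ℝ) with hS
    rw [← mul_div_assoc, div_le_iff₀ (by positivity)]
    calc 2 ^ 2 ^ (L + 3) * ((2 * (m : ℝ)) ^ L * 2 ^ (L + 1) * (32 * l))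
        ≤ 2 ^ 2 ^ (L + 3) * ((2 * (2 ^ (e + 1) * r * S)) ^ L * 2 ^ (L + 1) * (32 * l)) := by
          gcongr
      _ = 1 / 16 * ((K * r ^ L) * S ^ L) := by
          rw [hK]
          push_cast
          rw [pow_mul (2 : ℝ) (e + 1) L, mul_pow, mul_pow, mul_pow]
          ring
      _ ≤ _ := by gcongr
  · have h1 : 3 * p ^ (6 * r ^ e + 1) * m ^ c ≤ 2 ^ m := by
      calc 3 * p ^ (6 * r ^ e + 1) * m ^ c ≤ p * p ^ (6 * r ^ e + 1) * p := by
            gcongr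
            omega
        _ = p ^ (6 * r ^ e + 3) := by ring
        _ ≤ p ^ (9 * r ^ e) := Nat.pow_le_pow_right hp.pos (by omega)
        _ ≤ 2 ^ r ^ (e + 1) := hpow
        _ ≤ 2 ^ m := Nat.pow_le_pow_right (by norm_num) hr1
    exact_mod_cast h1

lemma probSym_pow_four_le_of_large {c : ℕ} (hc : 0 < c) : ∃ m₀ : ℕ, ∀ m ≥ m₀,
    0 < m ∧ ∀ Q : Matrix (Fin (m + 1)) (Fin (m + 1)) ℝ → Prop,
      (∀ M, Q M → M.det = 0 ∧ (M.submatrix Fin.succ Fin.succ).rank = m) →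
      probSym (m + 1) Q ^ 4 ≤ 3 / (m : ℝ) ^ c := by
  obtain ⟨m₀, h⟩ := exists_parameters hc
  refine ⟨m₀, fun m hm => ?_⟩
  obtain ⟨p, s, k, l, L, t, hp, hp2, hl, hL, hs, hm0, ht0, hβp, hexp, hkt, htriv, hsm, hmp, hms, hk,
    hfin⟩ := h m hm
  refine ⟨hm0, fun Q hQ => ?_⟩
  have := Fact.mk hp
  set X : ℝ := (m : ℝ) ^ c with hX
  have hX0 : 0 < X := by positivity
  obtain ⟨J, -, hJ⟩ := Finset.exists_subset_card_eq
    (show s ≤ (Finset.univ : Finset (Fin m)).card by simp; omega)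
  have hbad := card_badMatrices_le (p := p) hp2 (J := J) (β := 1 / X) (t := t) hl hL hs hJ
    (by positivity) ht0 (by rw [one_div_mul_eq_div, le_div_iff₀ hX0]; exact hβp)
    (by
      rw [Real.exp_neg, div_div, one_div]
      exact inv_anti₀ (by positivity) (by linarith))
    hkt (by rw [one_div_mul_eq_div, le_div_iff₀ hX0]; exact htriv) hsm hmp
    (by
      rw [one_div, inv_pow, one_div]
      refine inv_strictAnti₀ hX0 (hms.trans_lt ?_)
      exact pow_lt_pow_right₀ (by norm_num) (by omega)) hk
  have hle := probSym_pow_four_le hp2 J (β := 1 / X) (by positivity) hbad hQ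
  refine hle.trans ?_
  have h1 : (1 / 2 : ℝ) ^ J.card ≤ 1 / X := by
    rw [hJ, one_div, inv_pow, one_div]
    exact inv_anti₀ hX0 hms
  have h2 : 3 * (p : ℝ) ^ (6 * s + 1) / 2 ^ m ≤ 1 / X := by
    rw [div_le_div_iff₀ (by positivity) hX0, one_mul]
    exact hfin
  calc _ ≤ 1 / X + 1 / X + 1 / X := by gcongr
    _ = 3 / X := by ring

lemma probSym_le_one (n : ℕ) (Q : Matrix (Fin n) (Fin n) ℝ → Prop) : probSym n Q ≤ 1 := by
  unfold probSym
  exact div_le_one_of_le₀ (Nat.cast_le.2 (Finset.card_le_univ _)) (Nat.cast_nonneg _)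

end Parameters

/-- For every `C > 0` there is `K > 0` such that for all `n ≥ 2`,
`P(det(M_n) = 0 ∧ rank(M_{n-1}) = n - 1) ≤ K · n^{-C}`, where `M_{n-1}` is the principal
submatrix of `M_n` obtained by deleting the first row and the first column. -/
theorem singularity_case_nondegenerate :
    ∀ C : ℝ, 0 < C → ∃ K : ℝ, 0 < K ∧ ∀ n : ℕ, ∀ hn : 2 ≤ n,
      probSym n (fun M => M.det = 0 ∧
          (M.submatrix (fun i : Fin (n - 1) => Fin.cast (by omega) i.succ)
            (fun i : Fin (n - 1) => Fin.cast (by omega) i.succ)).rank = n - 1) ≤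
        K * (n : ℝ) ^ (-C) := by
  intro C hC
  obtain ⟨c, hcC⟩ := exists_nat_ge (4 * C)
  have hc : 0 < c := by
    rcases Nat.eq_zero_or_pos c with rfl | h
    · rw [Nat.cast_zero] at hcC
      linarith
    · exact h
  obtain ⟨m₀, hm₀⟩ := probSym_pow_four_le_of_large hc
  refine ⟨3 * 2 ^ c + (m₀ + 1 : ℝ) ^ C, by positivity, fun n hn => ?_⟩
  obtain ⟨m, rfl⟩ : ∃ m, n = m + 1 := ⟨n - 1, by omega⟩
  have hn0 : (0 : ℝ) < ((m + 1 : ℕ) : ℝ) := by positivity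
  rcases lt_or_ge m m₀ with hm | hm
  · refine (probSym_le_one _ _).trans ?_
    rw [Real.rpow_neg hn0.le, ← div_eq_mul_inv, one_le_div (by positivity)]
    have h1 : ((m + 1 : ℕ) : ℝ) ^ C ≤ (m₀ + 1 : ℝ) ^ C := by
      refine Real.rpow_le_rpow hn0.le ?_ hC.le
      push_cast
      have : (m : ℝ) ≤ m₀ := by exact_mod_cast hm.le
      linarith
    have h2 : (0 : ℝ) ≤ 3 * 2 ^ c := by positivity
    linarith
  · obtain ⟨hm0, h⟩ := hm₀ m hm
    have hP := h (fun M => M.det = 0 ∧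
      (M.submatrix (fun i : Fin (m + 1 - 1) => Fin.cast (by omega) i.succ)
        (fun i : Fin (m + 1 - 1) => Fin.cast (by omega) i.succ)).rank = m + 1 - 1)
      fun M hM => hM
    refine le_of_pow_le_pow_left₀ (n := 4) (by norm_num) (by positivity) (hP.trans ?_)
    have hm1 : (1 : ℝ) ≤ m := by exact_mod_cast hm0
    set X : ℝ := ((m + 1 : ℕ) : ℝ) with hX
    have hX1 : 1 ≤ X := by rw [hX]; push_cast; linarith
    have hXm : X ≤ 2 * m := by rw [hX]; push_cast; linarith
    have hrp : (X ^ (-C)) ^ 4 = X ^ (-(4 * C)) := by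
      rw [← Real.rpow_natCast, ← Real.rpow_mul hn0.le]
      congr 1
      push_cast
      ring
    have h1 : X ^ (-(c : ℝ)) ≤ X ^ (-(4 * C)) :=
      Real.rpow_le_rpow_of_exponent_le hX1 (by linarith)
    have h2 : 1 / (m : ℝ) ^ c ≤ 2 ^ c * X ^ (-(c : ℝ)) := by
      rw [Real.rpow_neg hn0.le, Real.rpow_natCast, ← div_eq_mul_inv,
        div_le_div_iff₀ (by positivity) (by positivity), one_mul, ← mul_pow]
      exact pow_le_pow_left₀ hn0.le hXm c
    have h3 : (3 * 2 ^ c : ℝ) ≤ (3 * 2 ^ c + (m₀ + 1 : ℝ) ^ C) ^ 4 := by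
      have hp1 : (1 : ℝ) ≤ 2 ^ c := one_le_pow₀ (by norm_num)
      have hp2 : (0 : ℝ) ≤ (m₀ + 1 : ℝ) ^ C := by positivity
      calc (3 * 2 ^ c : ℝ) ≤ 3 * 2 ^ c + (m₀ + 1 : ℝ) ^ C := by linarith
        _ ≤ _ := le_self_pow₀ (by linarith) (by norm_num)
    calc 3 / (m : ℝ) ^ c = 3 * (1 / (m : ℝ) ^ c) := by ring
      _ ≤ 3 * (2 ^ c * X ^ (-(4 * C))) := by gcongr; exact h2.trans (by gcongr)
      _ = 3 * 2 ^ c * X ^ (-(4 * C)) := by ring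
      _ ≤ (3 * 2 ^ c + (m₀ + 1 : ℝ) ^ C) ^ 4 * X ^ (-(4 * C)) := by gcongr
      _ = _ := by rw [mul_pow, hrp]

end
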